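/- arXiv:1110.0795 — 2 statements merged into one kernel-verified Lean document; each statement's English description precedes it below -/
import Mathlib

section
/- Let (R,M) be a two-dimensional regular local ring with algebraically closed residue field. Then every complete M-primary ideal I of R is normal, i.e., every power I^n is complete (integrally closed). -/
open IsLocalRing

/-- `x` is integral over the ideal `I`: it satisfies an equation
`x ^ n + c 1 * x ^ (n - 1) + ⋯ + c n = 0` with `c i ∈ I ^ i`. -/
def Ideal.IsIntegralElemOver {R : Type*} [CommRing R] (I : Ideal R) (x : R) : Prop :=
  ∃ n : ℕ, 0 < n ∧ ∃ c : ℕ → R, (∀ i ∈ Finset.Icc 1 n, c i ∈ I ^ i) ∧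
    x ^ n + ∑ i ∈ Finset.Icc 1 n, c i * x ^ (n - i) = 0

/-- An ideal is complete (integrally closed) if it contains every element integral over it. -/
def Ideal.IsComplete {R : Type*} [CommRing R] (I : Ideal R) : Prop :=
  ∀ x : R, I.IsIntegralElemOver x → x ∈ I

/-- An ideal of a local ring is `M`-primary if its radical is the maximal ideal. -/
def Ideal.IsMPrimary {R : Type*} [CommRing R] [IsLocalRing R] (I : Ideal R) : Prop :=
  I.radical = maximalIdeal R

namespace ZarC

section ic
variable {R : Type*} [CommRing R]

/-- Working notion of integrality over an ideal. -/
def IC (I : Ideal R) (g : R) : Prop :=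
  ∃ N : Ideal R, N ≠ ⊥ ∧ ∀ n ∈ N, g * n ∈ I * N

/-- Working notion of completeness. -/
def Cpl (I : Ideal R) : Prop := ∀ g : R, IC I g → g ∈ I

theorem ic_of_integral [IsDomain R] {I : Ideal R} {g : R} (h : I.IsIntegralElemOver g) :
    IC I g := by
  obtain ⟨n, hn, c, hc, heq⟩ := h
  by_cases hg : g = 0
  · exact ⟨⊤, top_ne_bot, fun n _ => by simp [hg]⟩
  let N : Ideal R := ⨆ j ∈ Finset.range n, I ^ j * Ideal.span {g ^ (n - 1 - j)}
  have hle : ∀ j < n, I ^ j * Ideal.span {g ^ (n - 1 - j)} ≤ N := fun j hj =>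
    le_iSup₂_of_le j (Finset.mem_range.2 hj) le_rfl
  have hmem : ∀ j < n, ∀ a ∈ I ^ j, a * g ^ (n - 1 - j) ∈ N := fun j hj a ha =>
    hle j hj (Ideal.mul_mem_mul ha (Ideal.mem_span_singleton_self _))
  have hmem' : ∀ j < n, ∀ a ∈ I ^ (j + 1), a * g ^ (n - 1 - j) ∈ I * N := by
    intro j hj a ha
    have h1 : a * g ^ (n - 1 - j) ∈ I ^ (j + 1) * Ideal.span {g ^ (n - 1 - j)} :=
      Ideal.mul_mem_mul ha (Ideal.mem_span_singleton_self _)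
    rw [pow_succ', mul_assoc] at h1
    exact Ideal.mul_mono_right (hle j hj) h1
  refine ⟨N, ?_, ?_⟩
  · intro hb
    have := hmem 0 hn 1 (by simp)
    rw [hb] at this
    simp at this
    exact hg this.1
  · have : N ≤ Submodule.comap (LinearMap.mulLeft R g) (I * N) := by
      refine iSup₂_le fun j hj => ?_
      rw [Finset.mem_range] at hj
      rw [Ideal.mul_le]
      intro a ha b hb
      obtain ⟨d, rfl⟩ := Ideal.mem_span_singleton'.1 hb
      rw [Submodule.mem_comap, LinearMap.mulLeft_apply]
      rcases j with _ | j
      · have e : g * (a * (d * g ^ (n - 1 - 0))) = a * d * g ^ n := by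
          obtain ⟨m, rfl⟩ : ∃ m, n = m + 1 := ⟨n - 1, by omega⟩
          simp only [Nat.add_sub_cancel, Nat.sub_zero]; ring
        rw [e]
        refine Ideal.mul_mem_left _ _ ?_
        rw [eq_neg_of_add_eq_zero_left heq]
        refine neg_mem (Ideal.sum_mem _ fun i hi => ?_)
        have hi' := Finset.mem_Icc.1 hi
        obtain ⟨i, rfl⟩ : ∃ m, i = m + 1 := ⟨i - 1, by omega⟩
        have := hmem' i (by omega) _ (hc _ hi)
        rwa [show n - 1 - i = n - (i + 1) by omega] at this
      · have e : g * (a * (d * g ^ (n - 1 - (j + 1)))) = d * (a * g ^ (n - 1 - j)) := by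
          rw [show n - 1 - j = (n - 1 - (j + 1)) + 1 by omega]; ring
        rw [e]
        exact Ideal.mul_mem_left _ _ (hmem' j (by omega) a ha)
    intro m hm
    exact this hm

theorem integral_of_ic [IsDomain R] [IsNoetherianRing R] {I : Ideal R} {g : R} (h : IC I g) :
    I.IsIntegralElemOver g := by
  obtain ⟨N, hN, h⟩ := h
  obtain ⟨p, hp, hdeg, hc, h0⟩ :=
    LinearMap.exists_monic_and_natDegree_eq_and_coeff_mem_pow_and_aeval_eq_zero R
      (M := N) (LinearMap.lsmul R N g) I (by
        rintro _ ⟨⟨n, hn⟩, rfl⟩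
        have h1 := h n hn
        have : ((LinearMap.lsmul R N g ⟨n, hn⟩ : N) : R) ∈
            Submodule.map N.subtype (I • (⊤ : Submodule R N)) := by
          rw [Submodule.map_smul'', Submodule.map_top, Submodule.range_subtype]
          simpa using h1
        obtain ⟨w, hw, hw'⟩ := this
        rwa [← Subtype.ext hw'])
  obtain ⟨n, hn, hn0⟩ := Submodule.exists_mem_ne_zero_of_ne_bot hN
  have hev : p.eval g = 0 := by
    have h2 := congrArg (fun f => ((f ⟨n, hn⟩ : N) : R)) h0
    have h3 : Polynomial.aeval (LinearMap.lsmul R N g) p = LinearMap.lsmul R N (p.eval g) := by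
      have : (LinearMap.lsmul R N g) = Algebra.lsmul R R N g := rfl
      rw [this, Polynomial.aeval_algHom_apply]; simp; rfl
    rw [h3] at h2
    simpa [hn0] using h2
  have hpos : 0 < p.natDegree := by
    rcases Nat.eq_zero_or_pos p.natDegree with h4 | h4
    · rw [hp.natDegree_eq_zero.1 h4] at hev
      simp at hev
    · exact h4
  refine ⟨p.natDegree, hpos, fun i => p.coeff (p.natDegree - i), ?_, ?_⟩
  · intro i hi
    have hi' := Finset.mem_Icc.1 hi
    have := hc (p.natDegree - i)
    rwa [show p.natDegree - (p.natDegree - i) = i by omega] at this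
  · rw [Polynomial.eval_eq_sum_range, Finset.sum_range_succ, hp.coeff_natDegree, one_mul,
      add_comm] at hev
    rw [← hev]
    congr 1
    refine Finset.sum_bij' (fun i _ => p.natDegree - i) (fun i _ => p.natDegree - i) ?_ ?_ ?_ ?_ ?_
    all_goals intro i hi; simp only [Finset.mem_Icc, Finset.mem_range] at *
    all_goals first | omega | rfl

theorem cpl_iff [IsDomain R] [IsNoetherianRing R] {I : Ideal R} : I.IsComplete ↔ Cpl I :=
  ⟨fun h g hg => h g (integral_of_ic hg), fun h g hg => h g (ic_of_integral hg)⟩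

/-- Integral closure of an ideal. -/
def icl [IsDomain R] (I : Ideal R) : Ideal R where
  carrier := {g | IC I g}
  zero_mem' := ⟨⊤, top_ne_bot, fun n _ => by simp⟩
  add_mem' := by
    rintro a b ⟨N, hN, h⟩ ⟨N', hN', h'⟩
    refine ⟨N * N', mul_ne_zero hN hN', ?_⟩
    have : N * N' ≤ Submodule.comap (LinearMap.mulLeft R (a + b)) (I * (N * N')) := by
      rw [Ideal.mul_le]
      intro n hn m hm
      rw [Submodule.mem_comap, LinearMap.mulLeft_apply,
        show (a + b) * (n * m) = (a * n) * m + n * (b * m) by ring]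
      refine add_mem ?_ ?_
      · rw [← mul_assoc]; exact Ideal.mul_mem_mul (h n hn) hm
      · rw [mul_left_comm]; exact Ideal.mul_mem_mul hn (h' m hm)
    exact fun n hn => this hn
  smul_mem' := by
    rintro c a ⟨N, hN, h⟩
    refine ⟨N, hN, fun n hn => ?_⟩
    rw [smul_eq_mul, mul_assoc]
    exact Ideal.mul_mem_left _ _ (h n hn)

theorem mem_icl [IsDomain R] {I : Ideal R} {g : R} : g ∈ icl I ↔ IC I g := Iff.rfl

theorem le_icl [IsDomain R] (I : Ideal R) : I ≤ icl I := fun g hg =>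
  ⟨⊤, top_ne_bot, fun n hn => Ideal.mul_mem_mul hg hn⟩

theorem icl_le [IsDomain R] {I J : Ideal R} (h : I ≤ J) (hJ : Cpl J) : icl I ≤ J := by
  rintro g ⟨N, hN, h1⟩
  exact hJ g ⟨N, hN, fun n hn => Ideal.mul_mono_left h (h1 n hn)⟩

theorem exists_icl_mul [IsDomain R] [IsNoetherianRing R] (I : Ideal R) :
    ∃ N : Ideal R, N ≠ ⊥ ∧ icl I * N ≤ I * N := by
  have key : ∀ s : Finset R, (∀ g ∈ s, IC I g) →
      ∃ N : Ideal R, N ≠ ⊥ ∧ Ideal.span (s : Set R) * N ≤ I * N := by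
    classical
    intro s
    induction s using Finset.induction_on with
    | empty => exact fun _ => ⟨⊤, top_ne_bot, by simp⟩
    | insert a s _ ih =>
      intro h
      obtain ⟨N, hN, h1⟩ := ih fun g hg => h g (Finset.mem_insert_of_mem hg)
      obtain ⟨N', hN', h2⟩ := h a (Finset.mem_insert_self _ _)
      refine ⟨N' * N, mul_ne_zero hN' hN, ?_⟩
      rw [Finset.coe_insert, Ideal.span_insert, Ideal.sup_mul]
      refine sup_le ?_ ?_
      · rw [← mul_assoc, ← mul_assoc]
        refine Ideal.mul_mono_left ?_
        rw [Ideal.span_singleton_mul_le_iff]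
        exact h2
      · rw [mul_left_comm, mul_left_comm I]
        exact Ideal.mul_mono_right h1
  obtain ⟨s, hs⟩ := (isNoetherianRing_iff_ideal_fg R).1 inferInstance (icl I)
  obtain ⟨N, hN, h⟩ := key s fun g hg => mem_icl.1 (hs ▸ Ideal.subset_span hg)
  exact ⟨N, hN, by rwa [show Ideal.span (s : Set R) = icl I from hs] at h⟩

theorem cpl_icl [IsDomain R] [IsNoetherianRing R] (I : Ideal R) : Cpl (icl I) := by
  rintro g ⟨N, hN, h⟩
  obtain ⟨N', hN', h'⟩ := exists_icl_mul I
  refine ⟨N' * N, mul_ne_zero hN' hN, ?_⟩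
  have : Ideal.span {g} * (N' * N) ≤ I * (N' * N) := by
    rw [mul_left_comm]
    refine (Ideal.mul_mono_right (Ideal.span_singleton_mul_le_iff.2 h)).trans ?_
    rw [mul_left_comm, ← mul_assoc, ← mul_assoc]
    exact Ideal.mul_mono_left h'
  exact Ideal.span_singleton_mul_le_iff.1 this

end ic
end ZarC

namespace ZarC

section loc
variable {R : Type*} [CommRing R] [IsLocalRing R]

/-- A regular system of parameters. -/
structure Par (x y : R) : Prop where
  span : maximalIdeal R = Ideal.span {x, y}
  px : Prime x
  ndvd : ¬ x ∣ y

theorem Par.xm {x y : R} (P : Par x y) : x ∈ maximalIdeal R := by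
  rw [P.span]; exact Ideal.subset_span (by simp)

theorem Par.ym {x y : R} (P : Par x y) : y ∈ maximalIdeal R := by
  rw [P.span]; exact Ideal.subset_span (by simp)

theorem Par.ndvd_pow {x y : R} (P : Par x y) (n : ℕ) : ¬ x ∣ y ^ n :=
  fun h => P.ndvd (P.px.dvd_of_dvd_pow h)

theorem Par.ndvd_unit {x y : R} (P : Par x y) (n : ℕ) {u : R} (hu : IsUnit u) (w : R) :
    ¬ x ∣ u * y ^ n + x * w := by
  intro h
  rw [dvd_add_left (dvd_mul_right x w)] at h
  exact P.ndvd_pow n (hu.dvd_mul_left.1 h)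

/-- decomposition of elements of powers of the maximal ideal -/
theorem Par.decomp {x y : R} (P : Par x y) : ∀ (n : ℕ) {a : R}, a ∈ maximalIdeal R ^ (n + 1) →
    ∃ c, ∃ m ∈ maximalIdeal R ^ n, a = c * y ^ (n + 1) + x * m := by
  intro n
  induction n with
  | zero =>
    intro a ha
    rw [zero_add, pow_one, P.span, Ideal.mem_span_pair] at ha
    obtain ⟨c, d, rfl⟩ := ha
    exact ⟨d, c, by simp, by ring⟩
  | succ n ih =>
    intro a ha
    rw [pow_succ' (maximalIdeal R) (n + 1)] at ha
    refine Submodule.mul_induction_on ha ?_ ?_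
    · intro p hp q hq
      obtain ⟨c, m, hm, rfl⟩ := ih hq
      have hq' := hq
      rw [P.span, Ideal.mem_span_pair] at hp
      obtain ⟨s, t, rfl⟩ := hp
      refine ⟨t * c, s * (c * y ^ (n + 1) + x * m) + t * (y * m), ?_, by ring⟩
      refine add_mem (Ideal.mul_mem_left _ _ hq') (Ideal.mul_mem_left _ _ ?_)
      rw [pow_succ']
      exact Ideal.mul_mem_mul P.ym hm
    · rintro p q ⟨c, m, hm, rfl⟩ ⟨c', m', hm', rfl⟩
      exact ⟨c + c', m + m', add_mem hm hm', by ring⟩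

theorem Par.decomp' {x y : R} (P : Par x y) (n : ℕ) {a : R} (ha : a ∈ maximalIdeal R ^ n) :
    ∃ c m, y * m ∈ maximalIdeal R ^ n ∧ a = c * y ^ n + x * m := by
  rcases n with _ | n
  · exact ⟨a, 0, by simp, by simp⟩
  · obtain ⟨c, m, hm, h⟩ := P.decomp n ha
    exact ⟨c, m, by rw [pow_succ']; exact Ideal.mul_mem_mul P.ym hm, h⟩

theorem Par.colon_pow {x y : R} (P : Par x y) (n : ℕ) {h : R} [IsDomain R]
    (hx : x * h ∈ maximalIdeal R ^ (n + 1)) : h ∈ maximalIdeal R ^ n := by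
  obtain ⟨c, m, hm, e⟩ := P.decomp n hx
  have : x ∣ c * y ^ (n + 1) := ⟨h - m, by linear_combination -e⟩
  obtain ⟨d, rfl⟩ := (P.px.dvd_or_dvd this).resolve_right (P.ndvd_pow _)
  have : h = d * y ^ (n + 1) + m := mul_left_cancel₀ P.px.ne_zero (by rw [e]; ring)
  rw [this]
  exact add_mem (Ideal.mul_mem_left _ _ (Ideal.pow_le_pow_right (Nat.le_succ n)
    (Ideal.pow_mem_pow P.ym _))) hm

theorem Par.colon_pow' {x y : R} (P : Par x y) (i n : ℕ) {h : R} [IsDomain R]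
    (hx : x ^ i * h ∈ maximalIdeal R ^ (n + i)) : h ∈ maximalIdeal R ^ n := by
  induction i generalizing h with
  | zero => simpa using hx
  | succ i ih =>
    refine ih (P.colon_pow (n + i) ?_)
    rw [← mul_assoc, ← pow_succ']; exact hx

/-- Leading term of an element. -/
theorem Par.lead {x y : R} (P : Par x y) : ∀ (d : ℕ) {a : R}, a ∈ maximalIdeal R ^ d →
    a ∉ maximalIdeal R ^ (d + 1) →
    ∃ i m u w, i + m = d ∧ IsUnit u ∧
      a - x ^ i * (u * y ^ m + x * w) ∈ maximalIdeal R ^ (d + 1) := by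
  intro d
  induction d with
  | zero =>
    intro a _ h
    refine ⟨0, 0, a, 0, rfl, ?_, by simp⟩
    simpa using h
  | succ d ih =>
    intro a ha h
    obtain ⟨c, m, hm, rfl⟩ := P.decomp d ha
    by_cases hc : IsUnit c
    · exact ⟨0, d + 1, c, m, by simp, hc, by simp⟩
    · have hc' : c * y ^ (d + 1) ∈ maximalIdeal R ^ (d + 1 + 1) := by
        rw [pow_succ' _ (d + 1)]
        exact Ideal.mul_mem_mul ((mem_maximalIdeal c).2 hc) (Ideal.pow_mem_pow P.ym _)
      have hm' : m ∉ maximalIdeal R ^ (d + 1) := by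
        intro hm'
        refine h (add_mem hc' ?_)
        rw [pow_succ' _ (d + 1)]
        exact Ideal.mul_mem_mul P.xm hm'
      obtain ⟨i, n, u, w, hi, hu, hmem⟩ := ih hm hm'
      refine ⟨i + 1, n, u, w, by omega, hu, ?_⟩
      have : c * y ^ (d + 1) + x * m - x ^ (i + 1) * (u * y ^ n + x * w) =
        c * y ^ (d + 1) + x * (m - x ^ i * (u * y ^ n + x * w)) := by ring
      rw [this]
      refine add_mem hc' ?_
      rw [pow_succ' _ (d + 1)]
      exact Ideal.mul_mem_mul P.xm hmem

theorem Par.notMem_mul {x y : R} [IsDomain R] (P : Par x y) (d e : ℕ) {a b : R}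
    (ha : a ∈ maximalIdeal R ^ d) (ha' : a ∉ maximalIdeal R ^ (d + 1))
    (hb : b ∈ maximalIdeal R ^ e) (hb' : b ∉ maximalIdeal R ^ (e + 1)) :
    a * b ∉ maximalIdeal R ^ (d + e + 1) := by
  intro hab
  obtain ⟨i, m, u, w, rfl, hu, h1⟩ := P.lead d ha ha'
  obtain ⟨j, n, v, w', rfl, hv, h2⟩ := P.lead e hb hb'
  set A := x ^ i * (u * y ^ m + x * w)
  set B := x ^ j * (v * y ^ n + x * w')
  have h3 : a * (b - B) ∈ maximalIdeal R ^ (i + m + (j + n) + 1) := by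
    rw [add_assoc, pow_add]; exact Ideal.mul_mem_mul ha h2
  have hB : B ∈ maximalIdeal R ^ (j + n) := by
    have := sub_mem hb (Ideal.pow_le_pow_right (Nat.le_succ _) h2)
    simpa using this
  have h4 : (a - A) * B ∈ maximalIdeal R ^ (i + m + (j + n) + 1) := by
    rw [show i + m + (j + n) + 1 = (i + m + 1) + (j + n) by ring, pow_add]
    exact Ideal.mul_mem_mul h1 hB
  have h5 : A * B ∈ maximalIdeal R ^ (i + m + (j + n) + 1) := by
    have := sub_mem (sub_mem hab h3) h4
    rwa [show a * b - a * (b - B) - (a - A) * B = A * B by ring] at this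
  have h6 : A * B = x ^ (i + j) * ((u * v) * y ^ (m + n) +
      x * (u * y ^ m * w' + w * (v * y ^ n + x * w'))) := by
    simp only [A, B]; ring
  rw [h6, show i + m + (j + n) + 1 = (m + n + 1) + (i + j) by ring] at h5
  have h7 := P.colon_pow' _ _ h5
  obtain ⟨c, k, -, hk⟩ := P.decomp _ h7
  have hun : IsUnit (u * v - c * y) := by
    have := (mem_maximalIdeal _).1 (Ideal.mul_mem_left _ c P.ym)
    by_contra hcon
    have h8 := add_mem ((mem_maximalIdeal _).2 hcon) (Ideal.mul_mem_left _ c P.ym)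
    rw [sub_add_cancel] at h8
    exact (mem_maximalIdeal _).1 h8 (hu.mul hv)
  apply P.ndvd_unit (m + n) hun 0
  refine ⟨k - (u * y ^ m * w' + w * (v * y ^ n + x * w')), ?_⟩
  linear_combination hk

theorem exists_order [IsNoetherianRing R] {N : Ideal R} (hN : N ≠ ⊥) :
    ∃ s, N ≤ maximalIdeal R ^ s ∧ ¬ N ≤ maximalIdeal R ^ (s + 1) := by
  classical
  have : ∃ s, ¬ N ≤ maximalIdeal R ^ s := by
    by_contra h
    push Not at h
    have h1 := le_iInf h
    rw [Ideal.iInf_pow_eq_bot_of_isLocalRing _ (maximalIdeal.isMaximal R).ne_top] at h1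
    exact hN (le_bot_iff.1 h1)
  have h1 := Nat.find_spec this
  obtain ⟨s, hs⟩ : ∃ s, Nat.find this = s + 1 := by
    refine ⟨Nat.find this - 1, ?_⟩
    have : Nat.find this ≠ 0 := by
      intro h0
      rw [h0] at h1
      simp at h1
    omega
  refine ⟨s, ?_, hs ▸ h1⟩
  by_contra h2
  have := Nat.find_min' this h2
  omega

theorem exists_order_elem [IsNoetherianRing R] {a : R} (hN : a ≠ 0) :
    ∃ s, a ∈ maximalIdeal R ^ s ∧ a ∉ maximalIdeal R ^ (s + 1) := by
  obtain ⟨s, h1, h2⟩ := exists_order (N := Ideal.span {a}) (by simpa using hN)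
  exact ⟨s, by simpa using h1, by simpa using h2⟩

theorem Par.cpl_pow {x y : R} [IsDomain R] [IsNoetherianRing R] (P : Par x y) (n : ℕ) :
    Cpl (maximalIdeal R ^ n) := by
  rintro g ⟨N, hN, h⟩
  obtain ⟨s, h1, h2⟩ := exists_order hN
  obtain ⟨ν, hν, hν'⟩ := SetLike.not_le_iff_exists.1 h2
  by_contra hg
  have hg0 : g ≠ 0 := by rintro rfl; simp at hg
  obtain ⟨d, hd, hd'⟩ := exists_order_elem hg0
  have hdn : d < n := by
    by_contra hdn
    exact hg (Ideal.pow_le_pow_right (not_lt.1 hdn) hd)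
  refine P.notMem_mul d s hd hd' (h1 hν) hν' ?_
  have := Ideal.mul_mono_right h1 (h ν hν)
  rw [← pow_add] at this
  exact Ideal.pow_le_pow_right (by omega) this

/-- colon by an element -/
def col (I : Ideal R) (x : R) : Ideal R := Submodule.comap (LinearMap.mulLeft R x) I

theorem mem_col {I : Ideal R} {x h : R} : h ∈ col I x ↔ x * h ∈ I := Iff.rfl

theorem le_col (I : Ideal R) (x : R) : I ≤ col I x := fun _ h => I.mul_mem_left x h

/-- Contracted ideals -/
def Con (x y : R) (I : Ideal R) : Prop :=
  (∃ f ∈ I, ¬ x ∣ f ∧ ∀ i ∈ I, ∃ u w, i = u * f + x * w) ∧ ∀ h, x * h ∈ I → y * h ∈ I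

theorem Par.con_col {x y : R} [IsDomain R] (P : Par x y) {I J : Ideal R} (hI : Con x y I)
    (hJ : Con x y J) {h : R} (hh : x * h ∈ I * J) : h ∈ I * col J x ⊔ col I x * J := by
  obtain ⟨⟨f, hf, hxf, hfI⟩, -⟩ := hI
  obtain ⟨⟨g, hg, hxg, hgJ⟩, -⟩ := hJ
  have key : ∀ a ∈ I * J, ∃ c, ∃ k ∈ I * col J x ⊔ col I x * J, a = c * (f * g) + x * k := by
    intro a ha
    refine Submodule.mul_induction_on ha ?_ ?_
    · intro i hi j hj
      obtain ⟨u, i1, hi1⟩ := hfI i hi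
      obtain ⟨v, j1, hj1⟩ := hgJ j hj
      have hi2 : i1 ∈ col I x := by
        rw [mem_col, show x * i1 = i - u * f by rw [hi1]; ring]
        exact sub_mem hi (Ideal.mul_mem_left _ _ hf)
      have hj2 : j1 ∈ col J x := by
        rw [mem_col, show x * j1 = j - v * g by rw [hj1]; ring]
        exact sub_mem hj (Ideal.mul_mem_left _ _ hg)
      refine ⟨u * v, i1 * j + u * f * j1, add_mem ?_ ?_, ?_⟩
      · exact Ideal.mem_sup_right (Ideal.mul_mem_mul hi2 hj)
      · exact Ideal.mem_sup_left (Ideal.mul_mem_mul (Ideal.mul_mem_left _ _ hf) hj2)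
      · rw [hi1, hj1]; ring
    · rintro p q ⟨c, m, hm, rfl⟩ ⟨c', m', hm', rfl⟩
      exact ⟨c + c', m + m', add_mem hm hm', by ring⟩
  obtain ⟨c, k, hk, e⟩ := key _ hh
  have : x ∣ c * (f * g) := ⟨h - k, by linear_combination -e⟩
  obtain ⟨d, rfl⟩ := (P.px.dvd_or_dvd this).resolve_right
    (fun h => (P.px.dvd_or_dvd h).elim hxf hxg)
  have : h = d * (f * g) + k := mul_left_cancel₀ P.px.ne_zero (by rw [e]; ring)
  rw [this]
  exact add_mem (Ideal.mul_mem_left _ _ (Ideal.mem_sup_left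
    (Ideal.mul_mem_mul hf (le_col _ _ hg)))) hk

theorem Par.con_mul {x y : R} [IsDomain R] (P : Par x y) {I J : Ideal R} (hI : Con x y I)
    (hJ : Con x y J) : Con x y (I * J) := by
  refine ⟨?_, ?_⟩
  · obtain ⟨⟨f, hf, hxf, hfI⟩, -⟩ := hI
    obtain ⟨⟨g, hg, hxg, hgJ⟩, -⟩ := hJ
    refine ⟨f * g, Ideal.mul_mem_mul hf hg, fun h => (P.px.dvd_or_dvd h).elim hxf hxg, ?_⟩
    intro a ha
    refine Submodule.mul_induction_on ha ?_ ?_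
    · intro i hi j hj
      obtain ⟨u, i1, hi1⟩ := hfI i hi
      obtain ⟨v, j1, hj1⟩ := hgJ j hj
      exact ⟨u * v, i1 * j + u * f * j1, by rw [hi1, hj1]; ring⟩
    · rintro p q ⟨c, m, rfl⟩ ⟨c', m', rfl⟩
      exact ⟨c + c', m + m', by ring⟩
  · intro h hh
    have h1 := P.con_col hI hJ hh
    have h2 : I * col J x ⊔ col I x * J ≤ col (I * J) y := by
      refine sup_le (Ideal.mul_le.2 ?_) (Ideal.mul_le.2 ?_)
      · intro i hi j hj
        rw [mem_col, mul_left_comm]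
        exact Ideal.mul_mem_mul hi (hJ.2 j hj)
      · intro i hi j hj
        rw [mem_col, ← mul_assoc]
        exact Ideal.mul_mem_mul (hI.2 i hi) hj
    exact h2 h1

theorem Par.con_max {x y : R} (P : Par x y) : Con x y (maximalIdeal R) := by
  refine ⟨⟨y, P.ym, P.ndvd, ?_⟩, fun h _ => Ideal.mul_mem_right _ _ P.ym⟩
  intro i hi
  rw [P.span, Ideal.mem_span_pair] at hi
  obtain ⟨a, b, rfl⟩ := hi
  exact ⟨b, a, by ring⟩

theorem Par.con_one {x y : R} (P : Par x y) : Con x y (1 : Ideal R) := by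
  refine ⟨⟨1, by simp, fun h => P.px.not_isUnit (isUnit_of_dvd_one h), ?_⟩, by simp⟩
  exact fun i _ => ⟨i, 0, by ring⟩

theorem Par.con_pow {x y : R} [IsDomain R] (P : Par x y) {I : Ideal R} (hI : Con x y I) (n : ℕ) :
    Con x y (I ^ n) := by
  induction n with
  | zero => rw [pow_zero]; exact P.con_one
  | succ n ih => rw [pow_succ]; exact P.con_mul ih hI

theorem Par.con_contract {x y : R} [IsDomain R] (P : Par x y) {I : Ideal R} (hI : Con x y I)
    (L : ℕ) {g : R} (hg : x ^ L * g ∈ I * maximalIdeal R ^ L) : g ∈ I := by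
  induction L with
  | zero => simpa using hg
  | succ L ih =>
    refine ih ?_
    have hK : Con x y (I * maximalIdeal R ^ L) := P.con_mul hI (P.con_pow P.con_max L)
    have hg' : x * (x ^ L * g) ∈ I * maximalIdeal R ^ L * maximalIdeal R := by
      rw [← mul_assoc, ← pow_succ', mul_assoc I, ← pow_succ]; exact hg
    have h1 := P.con_col hK P.con_max hg'
    generalize I * maximalIdeal R ^ L = K at *
    have h4 : K * col (maximalIdeal R) x ≤ K := Ideal.mul_le_left
    refine (sup_le h4 ?_) h1
    rw [Ideal.mul_le]
    intro r hr s hs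
    rw [P.span, Ideal.mem_span_pair] at hs
    obtain ⟨a, b, rfl⟩ := hs
    have h2 := hK.2 r hr
    have h3 : x * r ∈ K := hr
    rw [show r * (a * x + b * y) = a * (x * r) + b * (y * r) by ring]
    exact add_mem (Ideal.mul_mem_left _ _ h3) (Ideal.mul_mem_left _ _ h2)

/-- The direction `x` is transversal for `I`, which has order `r + 1`. -/
def Dir (x y : R) (I : Ideal R) (r : ℕ) : Prop :=
  I ≤ maximalIdeal R ^ (r + 1) ∧
    ∃ u w, IsUnit u ∧ w ∈ maximalIdeal R ^ r ∧ u * y ^ (r + 1) + x * w ∈ I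

theorem Par.con_f {x y : R} (P : Par x y) {I : Ideal R} {r : ℕ}
    (hle : I ≤ maximalIdeal R ^ (r + 1)) {u w : R} (hu : IsUnit u) :
    ∀ i ∈ I, ∃ a b, i = a * (u * y ^ (r + 1) + x * w) + x * b := by
  intro i hi
  obtain ⟨c, m, hm, rfl⟩ := P.decomp r (hle hi)
  obtain ⟨u, rfl⟩ := hu
  refine ⟨c * ↑u⁻¹, m - c * ↑u⁻¹ * w, ?_⟩
  have : (↑u⁻¹ : R) * u = 1 := by simp
  linear_combination (-c * y ^ (r + 1)) * this

theorem Par.con_of_cpl {x y : R} [IsDomain R] (P : Par x y) {I : Ideal R} {r : ℕ}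
    (hD : Dir x y I r) (hI : Cpl I) : Con x y I := by
  obtain ⟨hle, u, w, hu, hw, hf⟩ := hD
  refine ⟨⟨_, hf, P.ndvd_unit _ hu _, P.con_f hle hu⟩, ?_⟩
  intro h hh
  have hM : h ∈ maximalIdeal R ^ r := P.colon_pow r (hle hh)
  refine hI _ ⟨maximalIdeal R ^ r, pow_ne_zero _ ?_, ?_⟩
  · intro h0
    have := P.xm
    rw [h0] at this
    exact P.px.ne_zero (by simpa using this)
  · intro n hn
    obtain ⟨c, m, hm, rfl⟩ := P.decomp' r hn
    obtain ⟨u, rfl⟩ := hu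
    have e : (↑u⁻¹ : R) * u = 1 := by simp
    have : y * h * (c * y ^ r + x * m) = c * ↑u⁻¹ * ((u * y ^ (r + 1) + x * w) * h)
        - c * ↑u⁻¹ * ((x * h) * w) + (x * h) * (y * m) := by
      linear_combination (-c * h * y ^ (r + 1)) * e
    rw [this]
    refine add_mem (sub_mem ?_ ?_) ?_
    · exact Ideal.mul_mem_left _ _ (Ideal.mul_mem_mul hf hM)
    · exact Ideal.mul_mem_left _ _ (Ideal.mul_mem_mul hh hw)
    · exact Ideal.mul_mem_mul hh hm

theorem Par.dir_mul {x y : R} (P : Par x y) {I : Ideal R} {r : ℕ}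
    (hD : Dir x y I r) : Dir x y (I * maximalIdeal R) (r + 1) := by
  obtain ⟨hle, u, w, hu, hw, hf⟩ := hD
  refine ⟨?_, u, w * y, hu, ?_, ?_⟩
  · rw [pow_succ]; exact Ideal.mul_mono_left hle
  · rw [pow_succ]; exact Ideal.mul_mem_mul hw P.ym
  · rw [show u * y ^ (r + 1 + 1) + x * (w * y) = (u * y ^ (r + 1) + x * w) * y by ring]
    exact Ideal.mul_mem_mul hf P.ym

theorem Par.cpl_mul {x y : R} [IsDomain R] [IsNoetherianRing R] (P : Par x y) {I : Ideal R} {r : ℕ}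
    (hD : Dir x y I r) (hI : Cpl I) : Cpl (I * maximalIdeal R) := by
  have hD' := P.dir_mul hD
  have hKle := icl_le hD'.1 (P.cpl_pow (r + 1 + 1))
  obtain ⟨hle', u, w, hu, hw, hf⟩ := hD'
  have hDK : Dir x y (icl (I * maximalIdeal R)) (r + 1) :=
    ⟨hKle, u, w, hu, hw, le_icl _ hf⟩
  have hKc := P.con_of_cpl hDK (cpl_icl _)
  intro g hg
  obtain ⟨a, h, e⟩ := P.con_f hKle (w := w) hu g hg
  have hxh : x * h ∈ icl (I * maximalIdeal R) := by
    rw [show x * h = g - a * (u * y ^ (r + 1 + 1) + x * w) by rw [e]; ring]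
    exact sub_mem hg (Ideal.mul_mem_left _ _ (le_icl _ hf))
  have hyh := hKc.2 h hxh
  have hm0 : maximalIdeal R ≠ ⊥ := by
    intro h0
    have := P.xm
    rw [h0] at this
    exact P.px.ne_zero (by simpa using this)
  have hhI : h ∈ I := by
    obtain ⟨N, hN, h1⟩ := exists_icl_mul (I * maximalIdeal R)
    refine hI h ⟨maximalIdeal R * N, mul_ne_zero hm0 hN, ?_⟩
    rw [← Ideal.span_singleton_mul_le_iff, ← mul_assoc, ← mul_assoc]
    refine le_trans (Ideal.mul_mono_left ?_) h1
    rw [Ideal.span_singleton_mul_le_iff]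
    intro s hs
    rw [P.span, Ideal.mem_span_pair] at hs
    obtain ⟨a, b, rfl⟩ := hs
    rw [show h * (a * x + b * y) = a * (x * h) + b * (y * h) by ring]
    exact add_mem (Ideal.mul_mem_left _ _ hxh) (Ideal.mul_mem_left _ _ hyh)
  rw [e]
  refine add_mem (Ideal.mul_mem_left _ _ hf) ?_
  rw [mul_comm x h]
  exact Ideal.mul_mem_mul hhI P.xm

theorem Par.cpl_mul_pow {x y : R} [IsDomain R] [IsNoetherianRing R] (P : Par x y) {I : Ideal R}
    {r : ℕ} (hD : Dir x y I r) (hI : Cpl I) (L : ℕ) : Cpl (I * maximalIdeal R ^ L) := by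
  have : Dir x y (I * maximalIdeal R ^ L) (r + L) ∧ Cpl (I * maximalIdeal R ^ L) := by
    induction L with
    | zero => simpa using ⟨hD, hI⟩
    | succ L ih =>
      rw [pow_succ, ← mul_assoc]
      exact ⟨P.dir_mul ih.1, P.cpl_mul ih.1 ih.2⟩
  exact this.2

end loc
end ZarC

namespace ZarC

section reg
variable {R : Type*} [CommRing R] [IsLocalRing R]

theorem span_prime [IsNoetherianRing R] (hh : 1 < (maximalIdeal R).height) {x y : R}
    (hs : maximalIdeal R = Ideal.span {x, y}) : (Ideal.span {x}).IsPrime ∧ y ∉ Ideal.span {x} := by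
  have hxm : x ∈ maximalIdeal R := by rw [hs]; exact Ideal.subset_span (by simp)
  have hym : y ∈ maximalIdeal R := by rw [hs]; exact Ideal.subset_span (by simp)
  have hy : ∀ n : ℕ, y ^ n ∉ Ideal.span {x} := by
    intro n hn
    have : maximalIdeal R ∈ (Ideal.span {x}).minimalPrimes := by
      refine ⟨⟨inferInstance, by simpa using hxm⟩, ?_⟩
      rintro Q ⟨hQ, hxQ⟩ -
      rw [hs, Ideal.span_le]
      rintro _ (rfl | rfl)
      · exact hxQ (Ideal.mem_span_singleton_self _)
      · exact hQ.mem_of_pow_mem n (hxQ hn)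
    have h1 := Ideal.height_le_one_of_isPrincipal_of_mem_minimalPrimes (Ideal.span {x}) _ this
    exact absurd hh (not_lt.2 h1)
  -- every element outside (x) is unit times a power of y modulo x
  have key : ∀ a, a ∉ Ideal.span {x} → ∃ u i d, IsUnit u ∧ a = u * y ^ i + x * d := by
    intro a ha
    let f := Ideal.Quotient.mk (Ideal.span {x})
    have : Nontrivial (R ⧸ Ideal.span {x}) :=
      Ideal.Quotient.nontrivial_iff.2 fun h => ha (h ▸ Submodule.mem_top)
    have hloc : IsLocalRing (R ⧸ Ideal.span {x}) :=
      IsLocalRing.of_surjective' f Ideal.Quotient.mk_surjective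
    have hmax : maximalIdeal (R ⧸ Ideal.span {x}) ≤ Ideal.span {f y} := by
      intro b hb
      obtain ⟨b, rfl⟩ := Ideal.Quotient.mk_surjective b
      have hb' : b ∈ maximalIdeal R := by
        rw [mem_maximalIdeal]
        intro hu
        exact (mem_maximalIdeal _).1 hb (hu.map f)
      rw [hs, Ideal.mem_span_pair] at hb'
      obtain ⟨p, q, rfl⟩ := hb'
      rw [Ideal.mem_span_singleton']
      refine ⟨f q, ?_⟩
      have : f x = 0 := Ideal.Quotient.eq_zero_iff_mem.2 (Ideal.mem_span_singleton_self x)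
      change f q * f y = f _
      rw [map_add, map_mul, this]; simp
    have hfa : f a ≠ 0 := fun h => ha (Ideal.Quotient.eq_zero_iff_mem.1 h)
    obtain ⟨s, h1, h2⟩ := exists_order_elem hfa
    have h3 : f a ∈ Ideal.span {f y ^ s} := by
      rw [← Ideal.span_singleton_pow]; exact Ideal.pow_right_mono hmax s h1
    obtain ⟨u, hu⟩ := Ideal.mem_span_singleton'.1 h3
    obtain ⟨u, rfl⟩ := Ideal.Quotient.mk_surjective u
    have h4 : a - u * y ^ s ∈ Ideal.span {x} := by
      rw [← Ideal.Quotient.eq_zero_iff_mem]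
      change f _ = 0
      rw [map_sub, map_mul, map_pow, ← hu]; exact sub_self _
    obtain ⟨d, hd⟩ := Ideal.mem_span_singleton'.1 h4
    refine ⟨u, s, d, ?_, by linear_combination -hd⟩
    by_contra hcon
    have hy' : f y ∈ maximalIdeal (R ⧸ Ideal.span {x}) := by
      rw [mem_maximalIdeal]
      intro hc
      have h0 := ((mem_maximalIdeal _).1 hym)
      have := IsLocalRing.surjective_units_map_of_local_ringHom f
        Ideal.Quotient.mk_surjective (IsLocalHom.of_surjective f Ideal.Quotient.mk_surjective)
      exact h0 ((IsLocalHom.of_surjective f Ideal.Quotient.mk_surjective).map_nonunit _ hc)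
    have hu' : f u ∈ maximalIdeal (R ⧸ Ideal.span {x}) := by
      rw [mem_maximalIdeal]
      intro hc
      exact hcon ((IsLocalHom.of_surjective f Ideal.Quotient.mk_surjective).map_nonunit _ hc)
    apply h2
    rw [← hu, pow_succ']
    exact Ideal.mul_mem_mul hu' (Ideal.pow_mem_pow hy' _)
  refine ⟨⟨?_, ?_⟩, by simpa using hy 1⟩
  · intro h
    exact hy 0 (h ▸ Submodule.mem_top)
  · intro a b hab
    by_contra hcon
    push Not at hcon
    obtain ⟨u, i, d, hu, rfl⟩ := key a hcon.1
    obtain ⟨v, j, e, hv, rfl⟩ := key b hcon.2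
    apply hy (i + j)
    have h5 : (u * v) * y ^ (i + j) ∈ Ideal.span {x} := by
      have : (u * v) * y ^ (i + j) = (u * y ^ i + x * d) * (v * y ^ j + x * e) -
        x * (d * (v * y ^ j + x * e) + u * y ^ i * e) := by ring
      rw [this]
      exact sub_mem hab (Ideal.mul_mem_right _ _ (Ideal.mem_span_singleton_self x))
    exact (Ideal.unit_mul_mem_iff_mem _ (hu.mul hv)).1 h5

theorem exists_par_domain [IsNoetherianRing R] [IsDomain R] (hh : 1 < (maximalIdeal R).height)
    {x y : R} (hs : maximalIdeal R = Ideal.span {x, y}) : Par x y := by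
  obtain ⟨h1, h2⟩ := span_prime hh hs
  refine ⟨hs, ?_, fun h => h2 (Ideal.mem_span_singleton.2 h)⟩
  refine (Ideal.span_singleton_prime ?_).1 h1
  rintro rfl
  have h3 := (span_prime hh (x := y) (y := 0) (by rw [hs, Set.pair_comm])).2
  simp at h3

theorem isDomain_of_height [IsNoetherianRing R] (hh : 1 < (maximalIdeal R).height)
    {x y : R} (hs : maximalIdeal R = Ideal.span {x, y}) : IsDomain R := by
  have hym : y ∈ maximalIdeal R := by rw [hs]; exact Ideal.subset_span (by simp)
  have hs' : ∀ n : ℕ, maximalIdeal R = Ideal.span {x + y ^ (n + 1), y} := by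
    intro n
    rw [hs]
    apply le_antisymm <;> rw [Ideal.span_le]
    · rintro _ (rfl | rfl)
      · exact Ideal.mem_span_pair.2 ⟨1, -y ^ n, by ring⟩
      · exact Ideal.subset_span (by simp)
    · rintro _ (rfl | rfl)
      · exact Ideal.mem_span_pair.2 ⟨1, y ^ n, by ring⟩
      · exact Ideal.subset_span (by simp)
  have hex : ∃ n : ℕ, Ideal.span {x + y ^ (n + 1)} ∉ minimalPrimes R := by
    by_contra hcon
    push Not at hcon
    have hfin := Ideal.finite_minimalPrimes_of_isNoetherianRing R ⊥
    have hinj : Function.Injective (fun n : ℕ => Ideal.span {x + y ^ (n + 1)}) := by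
      have aux : ∀ a b : ℕ, a < b →
          Ideal.span {x + y ^ (a + 1)} ≠ Ideal.span {x + y ^ (b + 1)} := by
        intro a b hab he
        obtain ⟨hp, hn⟩ := span_prime hh (hs' a)
        have h1 : x + y ^ (b + 1) ∈ Ideal.span {x + y ^ (a + 1)} := by
          rw [he]; exact Ideal.mem_span_singleton_self _
        have h2 := sub_mem (Ideal.mem_span_singleton_self (x + y ^ (a + 1))) h1
        obtain ⟨k, rfl⟩ : ∃ k, b = a + 1 + k := ⟨b - (a + 1), by omega⟩
        have h3 : x + y ^ (a + 1) - (x + y ^ (a + 1 + k + 1)) =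
          (1 - y ^ (k + 1)) * y ^ (a + 1) := by ring
        rw [h3] at h2
        have hu : IsUnit (1 - y ^ (k + 1)) := by
          by_contra hc
          have h4 := add_mem ((mem_maximalIdeal _).2 hc)
            (Ideal.pow_mem_of_mem _ hym (k + 1) (by omega))
          rw [sub_add_cancel] at h4
          exact (mem_maximalIdeal _).1 h4 isUnit_one
        exact hn (hp.mem_of_pow_mem _ ((Ideal.unit_mul_mem_iff_mem _ hu).1 h2))
      intro a b hab
      by_contra hne
      rcases lt_or_gt_of_ne hne with h | h
      · exact aux a b h hab
      · exact aux b a h hab.symm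
    exact Set.infinite_of_injective_forall_mem hinj hcon hfin
  obtain ⟨n, hn⟩ := hex
  obtain ⟨hp, -⟩ := span_prime hh (hs' n)
  set x' := x + y ^ (n + 1)
  obtain ⟨Q, hQ, hQle⟩ := Ideal.exists_minimalPrimes_le (I := ⊥) (J := Ideal.span {x'}) bot_le
  have hQp : Q.IsPrime := hQ.1.1
  have hne : x' ∉ Q := by
    intro h
    have : Q = Ideal.span {x'} := le_antisymm hQle (by simpa using h)
    exact hn (this ▸ hQ)
  have hbot : Q = ⊥ := by
    refine Submodule.eq_bot_of_le_smul_of_le_jacobson_bot (Ideal.span {x'}) Q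
      (IsNoetherian.noetherian _) ?_ ?_
    · intro q hq
      obtain ⟨d, rfl⟩ := Ideal.mem_span_singleton'.1 (hQle hq)
      have := (hQp.mem_or_mem hq).resolve_right hne
      rw [mul_comm]
      exact Submodule.smul_mem_smul (Ideal.mem_span_singleton_self _) this
    · rw [IsLocalRing.jacobson_eq_maximalIdeal ⊥ bot_ne_top]
      have : x' ∈ maximalIdeal R := by rw [hs' n]; exact Ideal.subset_span (Or.inl rfl)
      simpa using this
  rw [hbot] at hQp
  exact IsDomain.of_bot_isPrime R

open Polynomial in
theorem Par.poly {x y : R} (P : Par x y) : ∀ (d : ℕ) {f : R}, f ∈ maximalIdeal R ^ (d + 1) →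
    ∃ F : R[X], (∀ c, ∃ w ∈ maximalIdeal R ^ d, f = F.eval c * y ^ (d + 1) + (x - c * y) * w) ∧
      ((∀ i, F.coeff i ∈ maximalIdeal R) → f ∈ maximalIdeal R ^ (d + 2)) := by
  intro d
  induction d with
  | zero =>
    intro f hf
    rw [zero_add, pow_one, P.span, Ideal.mem_span_pair] at hf
    obtain ⟨b, a, rfl⟩ := hf
    refine ⟨C a + X * C b, fun c => ⟨b, by simp, by simp; ring⟩, fun h => ?_⟩
    have h0 := h 0
    have h1 := h 1
    simp at h0
    simp [coeff_C] at h1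
    rw [zero_add, pow_two]
    exact add_mem (Ideal.mul_mem_mul ((mem_maximalIdeal _).2 h1) P.xm)
      (Ideal.mul_mem_mul ((mem_maximalIdeal _).2 h0) P.ym)
  | succ d ih =>
    intro f hf
    obtain ⟨a, b, hb, rfl⟩ := P.decomp _ hf
    obtain ⟨F, hF, hF'⟩ := ih hb
    refine ⟨C a + X * F, fun c => ?_, fun h => ?_⟩
    · obtain ⟨w, hw, e⟩ := hF c
      refine ⟨b + c * (y * w), add_mem hb (Ideal.mul_mem_left _ _ ?_), ?_⟩
      · rw [pow_succ']; exact Ideal.mul_mem_mul P.ym hw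
      · simp only [eval_add, eval_C, eval_mul, eval_X]
        linear_combination c * y * e
    · have h0 := h 0
      simp only [coeff_add, coeff_C_zero, mul_coeff_zero, coeff_X_zero, zero_mul, add_zero] at h0
      have h1 : ∀ i, F.coeff i ∈ maximalIdeal R := by
        intro i
        have := h (i + 1)
        rwa [coeff_add, coeff_X_mul, coeff_C_succ, zero_add] at this
      refine add_mem ?_ ?_
      · rw [show d + 1 + 2 = (d + 1 + 1) + 1 by ring, pow_succ']
        exact Ideal.mul_mem_mul h0 (Ideal.pow_mem_pow P.ym _)
      · rw [show d + 1 + 2 = (d + 2) + 1 by ring, pow_succ']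
        exact Ideal.mul_mem_mul P.xm (hF' h1)

open Polynomial in
theorem exists_dir [IsNoetherianRing R] [IsDomain R] [Infinite (ResidueField R)]
    (hh : 1 < (maximalIdeal R).height)
    {x y : R} (hs : maximalIdeal R = Ideal.span {x, y}) {I : Ideal R} {r : ℕ}
    (h1 : I ≤ maximalIdeal R ^ (r + 1)) (h2 : ¬ I ≤ maximalIdeal R ^ (r + 2)) :
    ∃ x y : R, Par x y ∧ Dir x y I r := by
  obtain ⟨f, hf, hf'⟩ := SetLike.not_le_iff_exists.1 h2
  have P := exists_par_domain hh hs
  obtain ⟨F, hF, hF'⟩ := P.poly r (h1 hf)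
  have hF0 : F.map (residue R) ≠ 0 := by
    intro h0
    refine hf' (hF' fun i => ?_)
    have := congrArg (fun p => p.coeff i) h0
    simpa [residue_eq_zero_iff] using this
  obtain ⟨c, hc⟩ : ∃ c, (F.map (residue R)).eval c ≠ 0 := by
    by_contra hcon
    push Not at hcon
    exact hF0 (Polynomial.funext fun c => by simpa using hcon c)
  obtain ⟨c, rfl⟩ := residue_surjective c
  rw [eval_map, eval₂_at_apply] at hc
  have hu : IsUnit (F.eval c) := by
    by_contra hcon
    exact hc ((residue_eq_zero_iff _).2 ((mem_maximalIdeal _).2 hcon))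
  obtain ⟨w, hw, e⟩ := hF c
  refine ⟨x - c * y, y, exists_par_domain hh ?_, h1, F.eval c, w, hu, hw, e ▸ hf⟩
  rw [hs]
  apply le_antisymm <;> rw [Ideal.span_le]
  · rintro _ (rfl | rfl)
    · exact Ideal.mem_span_pair.2 ⟨1, c, by ring⟩
    · exact Ideal.subset_span (by simp)
  · rintro _ (rfl | rfl)
    · exact Ideal.mem_span_pair.2 ⟨1, -c, by ring⟩
    · exact Ideal.subset_span (by simp)

/-- Bound on the length of chains above `I`. -/
def Bd (I : Ideal R) (m : ℕ) : Prop :=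
  ∀ (n : ℕ) (c : ℕ → Ideal R), I ≤ c 0 → (∀ i < n, c i < c (i + 1)) → n ≤ m

theorem Bd.pow_le [IsNoetherianRing R] {I : Ideal R} {m : ℕ} (h : Bd I m) :
    maximalIdeal R ^ m ≤ I := by
  by_contra hcon
  have hstr : ∀ j ≤ m, I ⊔ maximalIdeal R ^ (j + 1) < I ⊔ maximalIdeal R ^ j := by
    intro j hj
    refine lt_of_le_of_ne (sup_le_sup_left (Ideal.pow_le_pow_right (Nat.le_succ _)) _) ?_
    intro he
    apply hcon
    refine (Ideal.pow_le_pow_right hj).trans ?_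
    have := Submodule.le_of_le_smul_of_le_jacobson_bot (I := maximalIdeal R) (N := I)
      (N' := maximalIdeal R ^ j) (IsNoetherian.noetherian _)
      (by rw [IsLocalRing.jacobson_eq_maximalIdeal ⊥ bot_ne_top]) (by
        rw [smul_eq_mul, ← pow_succ', he]; exact le_sup_right)
    exact this
  have := h (m + 1) (fun i => I ⊔ maximalIdeal R ^ (m + 1 - i)) le_sup_left (by
    intro i hi
    have h3 := hstr (m - i) (by omega)
    rwa [show m - i + 1 = m + 1 - i by omega, show m - i = m + 1 - (i + 1) by omega] at h3)
  omega

theorem exists_bd [IsNoetherianRing R] {I : Ideal R} {k : ℕ} (h : maximalIdeal R ^ k ≤ I) :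
    ∃ m, Bd I m := by
  by_cases hI : I = ⊤
  · refine ⟨0, fun n c h0 hc => ?_⟩
    by_contra hn
    have := hc 0 (by omega)
    rw [hI] at h0
    exact absurd (lt_of_le_of_lt h0 this) not_top_lt
  have : Nontrivial (R ⧸ I) := Ideal.Quotient.nontrivial_iff.2 hI
  let f := Ideal.Quotient.mk I
  have hloc : IsLocalRing (R ⧸ I) :=
    IsLocalRing.of_surjective' f Ideal.Quotient.mk_surjective
  have hart : IsArtinianRing (R ⧸ I) := by
    rw [isArtinianRing_iff_isNilpotent_maximalIdeal]
    refine ⟨k, ?_⟩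
    have hle : maximalIdeal (R ⧸ I) ≤ (maximalIdeal R).map f := by
      intro b hb
      obtain ⟨b, rfl⟩ := Ideal.Quotient.mk_surjective b
      refine Ideal.mem_map_of_mem f ?_
      rw [mem_maximalIdeal]
      intro hu
      exact (mem_maximalIdeal _).1 hb (hu.map f)
    rw [Ideal.zero_eq_bot, ← le_bot_iff]
    refine (Ideal.pow_right_mono hle k).trans ?_
    rw [← Ideal.map_pow, Ideal.map_le_iff_le_comap]
    intro a ha
    rw [Ideal.mem_comap, Ideal.mem_bot]
    exact Ideal.Quotient.eq_zero_iff_mem.2 (h ha)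
  have hlen : Module.length (R ⧸ I) (R ⧸ I) ≠ ⊤ := Module.length_ne_top
  rw [Module.length_ne_top_iff_finiteDimensionalOrder] at hlen
  refine ⟨(LTSeries.longestOf (Submodule (R ⧸ I) (R ⧸ I))).length, fun n c h0 hc => ?_⟩
  have hge : ∀ i ≤ n, I ≤ c i := by
    intro i
    induction i with
    | zero => exact fun _ => h0
    | succ i ih => exact fun hi => (ih (by omega)).trans (hc i (by omega)).le
  have hcm : ∀ i ≤ n, ((c i).map f).comap f = c i := by
    intro i hi
    rw [Ideal.comap_map_of_surjective f Ideal.Quotient.mk_surjective, sup_eq_left]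
    intro a ha
    exact hge i hi (Ideal.Quotient.eq_zero_iff_mem.1 (by simpa using ha))
  let s : LTSeries (Submodule (R ⧸ I) (R ⧸ I)) :=
    { length := n
      toFun := fun i => (c i).map f
      step := by
        intro i
        have hi := i.2
        have h1 := hc i hi
        change (c i).map f < (c (i + 1)).map f
        refine lt_of_le_of_ne (Ideal.map_mono h1.le) fun he => ?_
        have h2 := congrArg (Ideal.comap f) he
        rw [hcm _ (by omega), hcm _ (by omega)] at h2
        exact h1.ne h2 }
  exact LTSeries.longestOf_is_longest s

end reg
end ZarC

namespace ZarC

section tr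
open Polynomial
universe u
variable {R : Type u} [CommRing R] [IsLocalRing R]
variable {T : Type u} [CommRing T] [IsLocalRing T] [Algebra R T]

/-- `T` is a localisation of `R[y / x]`. -/
structure Tr (x y : R) (z : T) : Prop where
  inj : Function.Injective (algebraMap R T)
  hz : algebraMap R T x * z = algebraMap R T y
  frac : ∀ t : T, ∃ H G : R[X], IsUnit (aeval z H) ∧ aeval z H * t = aeval z G

theorem Par.toPoly {x y : R} (P : Par x y) {S : Type*} [CommRing S] [Algebra R S] {z : S}
    (hz : algebraMap R S x * z = algebraMap R S y) : ∀ (d : ℕ) {m : R},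
    m ∈ maximalIdeal R ^ d →
    ∃ G : R[X], G.natDegree ≤ d ∧ algebraMap R S m = algebraMap R S x ^ d * aeval z G := by
  intro d
  induction d with
  | zero => intro m _; exact ⟨C m, by simp, by simp⟩
  | succ d ih =>
    intro m hm
    obtain ⟨c, m', hm', rfl⟩ := P.decomp d hm
    obtain ⟨G, hG, e⟩ := ih hm'
    refine ⟨C c * X ^ (d + 1) + G, ?_, ?_⟩
    · refine natDegree_add_le_of_degree_le (natDegree_C_mul_X_pow_le _ _) (by omega)
    · simp only [map_add, map_mul, map_pow, e, ← hz, aeval_C, aeval_X]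
      ring

theorem Par.ofPoly {x y : R} (P : Par x y) {S : Type*} [CommRing S] [Algebra R S] {z : S}
    (hz : algebraMap R S x * z = algebraMap R S y) (G : R[X]) {L : ℕ} (hL : G.natDegree ≤ L) :
    algebraMap R S (∑ i ∈ Finset.range (L + 1), G.coeff i * (x ^ (L - i) * y ^ i)) =
      algebraMap R S x ^ L * aeval z G := by
  rw [aeval_eq_sum_range' (n := L + 1) (by omega), map_sum, Finset.mul_sum]
  refine Finset.sum_congr rfl fun i hi => ?_
  have hi' := Finset.mem_range.1 hi
  rw [map_mul, map_mul, map_pow, map_pow, ← hz, Algebra.smul_def,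
    show algebraMap R S x ^ L = algebraMap R S x ^ (L - i) * algebraMap R S x ^ i by
      rw [← pow_add]; congr 1; omega]
  ring

theorem Par.ofPoly_mem {x y : R} (P : Par x y) (G : R[X]) (L : ℕ) :
    (∑ i ∈ Finset.range (L + 1), G.coeff i * (x ^ (L - i) * y ^ i)) ∈ maximalIdeal R ^ L := by
  refine Ideal.sum_mem _ fun i hi => Ideal.mul_mem_left _ _ ?_
  have hi' := Finset.mem_range.1 hi
  have := Ideal.mul_mem_mul (Ideal.pow_mem_pow P.xm (L - i)) (Ideal.pow_mem_pow P.ym i)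
  rwa [← pow_add, show L - i + i = L by omega] at this

theorem Par.gr [IsDomain R] {x y : R} (P : Par x y) (a : ℕ → R) : ∀ (d : ℕ),
    (∑ i ∈ Finset.range (d + 1), a i * (x ^ (d - i) * y ^ i)) ∈ maximalIdeal R ^ (d + 1) →
    ∀ i ≤ d, a i ∈ maximalIdeal R := by
  intro d
  induction d with
  | zero =>
    intro h i hi
    obtain rfl : i = 0 := by omega
    simpa using h
  | succ d ih =>
    intro h
    rw [Finset.sum_range_succ] at h
    have e : ∑ i ∈ Finset.range (d + 1), a i * (x ^ (d + 1 - i) * y ^ i) =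
        x * ∑ i ∈ Finset.range (d + 1), a i * (x ^ (d - i) * y ^ i) := by
      rw [Finset.mul_sum]
      refine Finset.sum_congr rfl fun i hi => ?_
      have hi' := Finset.mem_range.1 hi
      rw [show d + 1 - i = d - i + 1 by omega]; ring
    rw [e] at h
    set SS := ∑ i ∈ Finset.range (d + 1), a i * (x ^ (d - i) * y ^ i)
    rw [Nat.sub_self, pow_zero, one_mul] at h
    have h1 : a (d + 1) ∈ maximalIdeal R := by
      obtain ⟨c, m, -, e2⟩ := P.decomp _ h
      have : x ∣ (a (d + 1) - c * y) * y ^ (d + 1) := ⟨m - SS, by linear_combination e2⟩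
      obtain ⟨k, hk⟩ := (P.px.dvd_or_dvd this).resolve_right (P.ndvd_pow _)
      rw [show a (d + 1) = k * x + c * y by linear_combination hk]
      exact add_mem (Ideal.mul_mem_left _ _ P.xm) (Ideal.mul_mem_left _ _ P.ym)
    have h2 : a (d + 1) * y ^ (d + 1) ∈ maximalIdeal R ^ (d + 1 + 1) := by
      rw [pow_succ' _ (d + 1)]
      exact Ideal.mul_mem_mul h1 (Ideal.pow_mem_pow P.ym _)
    have h3 := sub_mem h h2
    rw [add_sub_cancel_right] at h3
    have h4 := ih (P.colon_pow _ h3)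
    intro i hi
    rcases Nat.lt_or_ge d i with h5 | h5
    · obtain rfl : i = d + 1 := by omega
      exact h1
    · exact h4 i h5

theorem map_res_eq_zero {G : R[X]} : G.map (residue R) = 0 ↔ ∀ i, G.coeff i ∈ maximalIdeal R := by
  rw [Polynomial.ext_iff]
  simp [residue_eq_zero_iff]

variable {x y : R} {z : T}

theorem Tr.coef [IsDomain R] (P : Par x y) (D : Tr x y z) {G : R[X]}
    (h : aeval z G = 0) : G.map (residue R) = 0 := by
  rw [map_res_eq_zero]
  have h1 := P.ofPoly D.hz G le_rfl
  rw [h, mul_zero] at h1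
  have h2 := D.inj (h1.trans (map_zero _).symm)
  intro i
  rcases Nat.lt_or_ge G.natDegree i with h5 | h5
  · rw [coeff_eq_zero_of_natDegree_lt h5]; exact zero_mem _
  · exact P.gr G.coeff G.natDegree (by rw [h2]; exact zero_mem _) i h5

theorem Tr.max_le (P : Par x y) (D : Tr x y z) {m : R} (hm : m ∈ maximalIdeal R) :
    algebraMap R T m ∈ Ideal.span {algebraMap R T x} := by
  rw [P.span, Ideal.mem_span_pair] at hm
  obtain ⟨a, b, rfl⟩ := hm
  rw [Ideal.mem_span_singleton']
  refine ⟨algebraMap R T a + algebraMap R T b * z, ?_⟩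
  rw [map_add, map_mul, map_mul, ← D.hz]; ring

theorem Tr.red (P : Par x y) (D : Tr x y z) {G : R[X]} (h : G.map (residue R) = 0) :
    aeval z G ∈ Ideal.span {algebraMap R T x} := by
  rw [map_res_eq_zero] at h
  rw [aeval_eq_sum_range]
  refine Ideal.sum_mem _ fun i _ => ?_
  rw [Algebra.smul_def]
  exact Ideal.mul_mem_right _ _ (D.max_le P (h i))

theorem Tr.red' [IsDomain R] (P : Par x y) (D : Tr x y z)
    (hx : algebraMap R T x ∈ maximalIdeal T) {G : R[X]}
    (h : aeval z G ∈ Ideal.span {algebraMap R T x}) : G.map (residue R) = 0 := by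
  obtain ⟨t, ht⟩ := Ideal.mem_span_singleton'.1 h
  obtain ⟨H, G', hH, e⟩ := D.frac t
  have h1 : aeval z (H * G - C x * G') = 0 := by
    simp only [map_sub, map_mul, aeval_C, ← e, ← ht]; ring
  have h2 := D.coef P h1
  have hx0 : residue R x = 0 := (residue_eq_zero_iff _).2 P.xm
  rw [Polynomial.map_sub, Polynomial.map_mul, Polynomial.map_mul, map_C, hx0, C_0, zero_mul,
    sub_zero, mul_eq_zero] at h2
  refine h2.resolve_left fun h3 => ?_
  have h4 := D.red P h3
  have h5 : Ideal.span {algebraMap R T x} ≤ maximalIdeal T := by simpa using hx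
  exact (mem_maximalIdeal _).1 (h5 h4) hH

theorem Tr.prime [IsDomain R] (P : Par x y) (D : Tr x y z)
    (hx : algebraMap R T x ∈ maximalIdeal T) : (Ideal.span {algebraMap R T x}).IsPrime := by
  refine ⟨?_, ?_⟩
  · intro h
    rw [Ideal.span_singleton_eq_top] at h
    exact (mem_maximalIdeal _).1 hx h
  · intro a b hab
    obtain ⟨H, G, hH, e⟩ := D.frac a
    obtain ⟨H', G', hH', e'⟩ := D.frac b
    have h1 : aeval z (G * G') ∈ Ideal.span {algebraMap R T x} := by
      rw [map_mul, ← e, ← e', show aeval z H * a * (aeval z H' * b) =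
        (aeval z H * aeval z H') * (a * b) by ring]
      exact Ideal.mul_mem_left _ _ hab
    have h2 := D.red' P hx h1
    rw [Polynomial.map_mul, mul_eq_zero] at h2
    rcases h2 with h2 | h2
    · left
      have := D.red P h2
      rw [← e] at this
      exact (Ideal.unit_mul_mem_iff_mem _ hH).1 this
    · right
      have := D.red P h2
      rw [← e'] at this
      exact (Ideal.unit_mul_mem_iff_mem _ hH').1 this

theorem Tr.sub_eval (G : R[X]) (a : R) :
    aeval z G - algebraMap R T (G.eval a) ∈ Ideal.span {z - algebraMap R T a} := by
  rw [Ideal.mem_span_singleton]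
  have := sub_dvd_eval_sub z (algebraMap R T a) (G.map (algebraMap R T))
  rw [eval_map_algebraMap, eval_map_algebraMap, aeval_algebraMap_apply] at this
  simpa using this

theorem Tr.isLocalHom (P : Par x y) (D : Tr x y z)
    (hx : algebraMap R T x ∈ maximalIdeal T) : IsLocalHom (algebraMap R T) := by
  refine ⟨fun a ha => ?_⟩
  by_contra hcon
  have h1 := D.max_le P ((mem_maximalIdeal a).2 hcon)
  have h5 : Ideal.span {algebraMap R T x} ≤ maximalIdeal T := by simpa using hx
  exact (mem_maximalIdeal _).1 (h5 h1) ha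

theorem Tr.span (P : Par x y) (D : Tr x y z)
    (hx : algebraMap R T x ∈ maximalIdeal T) {a : R} (ha : z - algebraMap R T a ∈ maximalIdeal T) :
    maximalIdeal T = Ideal.span {algebraMap R T x, z - algebraMap R T a} := by
  apply le_antisymm
  · intro t ht
    obtain ⟨H, G, hH, e⟩ := D.frac t
    have h1 : aeval z G ∈ maximalIdeal T := by rw [← e]; exact Ideal.mul_mem_left _ _ ht
    have h2 := Tr.sub_eval (z := z) G a
    have h3 : Ideal.span {z - algebraMap R T a} ≤ maximalIdeal T := by simpa using ha
    have h4 : algebraMap R T (G.eval a) ∈ maximalIdeal T := by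
      have := sub_mem h1 (h3 h2)
      rwa [sub_sub_cancel] at this
    have h5 : G.eval a ∈ maximalIdeal R := by
      rw [mem_maximalIdeal]
      intro hu
      exact (mem_maximalIdeal _).1 h4 (hu.map _)
    have h6 := D.max_le P h5
    have h7 : aeval z G ∈ Ideal.span {algebraMap R T x, z - algebraMap R T a} := by
      rw [← sub_add_cancel (aeval z G) (algebraMap R T (G.eval a))]
      exact add_mem (Ideal.span_mono (by simp) h2) (Ideal.span_mono (by simp) h6)
    rw [← e] at h7
    exact (Ideal.unit_mul_mem_iff_mem _ hH).1 h7
  · rw [Ideal.span_le]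
    rintro _ (rfl | rfl)
    · exact hx
    · exact ha

theorem Tr.height [IsDomain R] [IsDomain T] [IsNoetherianRing T] (P : Par x y) (D : Tr x y z)
    (hx : algebraMap R T x ∈ maximalIdeal T) {a : R} (ha : z - algebraMap R T a ∈ maximalIdeal T) :
    1 < (maximalIdeal T).height := by
  have hp := D.prime P hx
  have h5 : Ideal.span {algebraMap R T x} ≤ maximalIdeal T := by simpa using hx
  have hlt : Ideal.span {algebraMap R T x} < maximalIdeal T := by
    refine lt_of_le_of_ne h5 fun he => ?_
    rw [← he] at ha
    have h1 : aeval z (X - C a) ∈ Ideal.span {algebraMap R T x} := by simpa using ha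
    have h2 := D.red' P hx h1
    rw [Polynomial.map_sub, map_X, map_C] at h2
    exact (monic_X_sub_C _).ne_zero h2
  have hbot : (⊥ : Ideal T) < Ideal.span {algebraMap R T x} := by
    rw [bot_lt_iff_ne_bot, Ne, Ideal.span_singleton_eq_bot]
    intro h0
    exact P.px.ne_zero (D.inj (h0.trans (map_zero _).symm))
  have h1 := Ideal.height_strict_mono_of_isPrime_of_isPrime hbot
  have h2 := Ideal.height_strict_mono_of_isPrime_of_isPrime hlt
  exact lt_of_le_of_lt (Order.one_le_iff_pos.2 (lt_of_le_of_lt bot_le h1)) h2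

theorem Tr.algClosed [IsAlgClosed (ResidueField R)] (P : Par x y) (D : Tr x y z)
    (hx : algebraMap R T x ∈ maximalIdeal T) {a : R} (ha : z - algebraMap R T a ∈ maximalIdeal T) :
    IsAlgClosed (ResidueField T) := by
  have := D.isLocalHom P hx
  have hsurj : Function.Surjective (ResidueField.map (algebraMap R T)) := by
    intro t
    obtain ⟨t, rfl⟩ := residue_surjective t
    obtain ⟨H, G, hH, e⟩ := D.frac t
    have key : ∀ F : R[X], residue T (aeval z F) =
        ResidueField.map (algebraMap R T) (residue R (F.eval a)) := by
      intro F
      rw [ResidueField.map_residue, ← sub_eq_zero, ← map_sub, residue_eq_zero_iff]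
      have h3 : Ideal.span {z - algebraMap R T a} ≤ maximalIdeal T := by simpa using ha
      exact h3 (Tr.sub_eval F a)
    have h1 := congrArg (residue T) e
    rw [map_mul, key, key] at h1
    have h2 : ResidueField.map (algebraMap R T) (residue R (H.eval a)) ≠ 0 := by
      rw [← key]
      intro h0
      exact (mem_maximalIdeal _).1 ((residue_eq_zero_iff _).1 h0) hH
    refine ⟨residue R (G.eval a) / residue R (H.eval a), ?_⟩
    rw [map_div₀, div_eq_iff h2, ← h1, mul_comm]
  exact IsAlgClosed.of_ringEquiv _ _
    (RingEquiv.ofBijective _ ⟨RingHom.injective _, hsurj⟩)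

end tr
end ZarC

namespace ZarC

section tr2
open Polynomial
universe u
variable {R : Type u} [CommRing R] [IsLocalRing R]
variable {T : Type u} [CommRing T] [IsLocalRing T] [Algebra R T]
variable {x y : R} {z : T}

theorem Tr.map_pow (P : Par x y) (D : Tr x y z) (d : ℕ) :
    (maximalIdeal R ^ d).map (algebraMap R T) ≤ Ideal.span {algebraMap R T x ^ d} := by
  rw [Ideal.map_pow, ← Ideal.span_singleton_pow]
  refine Ideal.pow_right_mono ?_ d
  rw [Ideal.map_le_iff_le_comap]
  exact fun m hm => D.max_le P hm

theorem Tr.den (P : Par x y) (D : Tr x y z) {J : Ideal R} {t : T}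
    (ht : t ∈ J.map (algebraMap R T)) :
    ∃ (L : ℕ) (q v : R) (ε : T), q ∈ maximalIdeal R ^ L ∧ v ∈ J * maximalIdeal R ^ L ∧
      IsUnit ε ∧ algebraMap R T q = algebraMap R T x ^ L * ε ∧
      algebraMap R T q * t = algebraMap R T v := by
  refine Submodule.span_induction (p := fun t _ => ∃ (L : ℕ) (q v : R) (ε : T),
      q ∈ maximalIdeal R ^ L ∧ v ∈ J * maximalIdeal R ^ L ∧
      IsUnit ε ∧ algebraMap R T q = algebraMap R T x ^ L * ε ∧
      algebraMap R T q * t = algebraMap R T v) ?_ ?_ ?_ ?_ ht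
  · rintro _ ⟨j, hj, rfl⟩
    exact ⟨0, 1, j, 1, by simp, by simpa using hj, isUnit_one, by simp, by simp⟩
  · exact ⟨0, 1, 0, 1, by simp, zero_mem _, isUnit_one, by simp, by simp⟩
  · rintro a b _ _ ⟨L₁, q₁, v₁, ε₁, hq₁, hv₁, hε₁, e₁, f₁⟩ ⟨L₂, q₂, v₂, ε₂, hq₂, hv₂, hε₂, e₂, f₂⟩
    refine ⟨L₁ + L₂, q₁ * q₂, v₁ * q₂ + v₂ * q₁, ε₁ * ε₂, ?_, ?_, hε₁.mul hε₂, ?_, ?_⟩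
    · rw [pow_add]; exact Ideal.mul_mem_mul hq₁ hq₂
    · refine add_mem ?_ ?_
      · rw [pow_add, ← mul_assoc]; exact Ideal.mul_mem_mul hv₁ hq₂
      · rw [add_comm, pow_add, ← mul_assoc]; exact Ideal.mul_mem_mul hv₂ hq₁
    · rw [map_mul, e₁, e₂]; ring
    · simp only [map_mul, map_add, ← f₁, ← f₂]; ring
  · rintro a t _ ⟨L, q, v, ε, hq, hv, hε, e, f⟩
    obtain ⟨H, G, hH, e'⟩ := D.frac a
    set L' := max H.natDegree G.natDegree
    have h1 := P.ofPoly D.hz H (le_max_left _ _ : _ ≤ L')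
    have h2 := P.ofPoly D.hz G (le_max_right _ _ : _ ≤ L')
    have h3 := P.ofPoly_mem H L'
    have h4 := P.ofPoly_mem G L'
    set h := ∑ i ∈ Finset.range (L' + 1), H.coeff i * (x ^ (L' - i) * y ^ i)
    set g := ∑ i ∈ Finset.range (L' + 1), G.coeff i * (x ^ (L' - i) * y ^ i)
    refine ⟨L + L', q * h, v * g, ε * aeval z H, ?_, ?_, hε.mul hH, ?_, ?_⟩
    · rw [pow_add]; exact Ideal.mul_mem_mul hq h3
    · rw [pow_add, ← mul_assoc]; exact Ideal.mul_mem_mul hv h4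
    · rw [map_mul, e, h1]; ring
    · rw [map_mul, map_mul, ← f, h1, h2, ← e', smul_eq_mul]; ring

theorem Tr.x_ne [IsDomain R] (P : Par x y) (D : Tr x y z) : algebraMap R T x ≠ 0 := by
  intro h0
  exact P.px.ne_zero (D.inj (h0.trans (map_zero _).symm))

theorem mem_of_mul_mem_span_mul [IsDomain T] {a t : T} (ha : a ≠ 0) {J : Ideal T}
    (h : a * t ∈ Ideal.span {a} * J) : t ∈ J := by
  obtain ⟨s, hs, e⟩ := Ideal.mem_span_singleton_mul.1 h
  rwa [← mul_left_cancel₀ ha e]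

theorem Tr.map_mul_pow (P : Par x y) (D : Tr x y z) (J : Ideal R) (d : ℕ) :
    (J * maximalIdeal R ^ d).map (algebraMap R T) ≤
      Ideal.span {algebraMap R T x ^ d} * J.map (algebraMap R T) := by
  rw [Ideal.map_mul, mul_comm]
  exact Ideal.mul_mono_left (D.map_pow P d)

/-- transform -/
def trf (T : Type u) [CommRing T] [Algebra R T] (x : R) (I : Ideal R) (d : ℕ) : Ideal T :=
  Submodule.comap (LinearMap.mulLeft T (algebraMap R T x ^ d)) (I.map (algebraMap R T))

theorem mem_trf {I : Ideal R} {d : ℕ} {t : T} :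
    t ∈ trf T x I d ↔ algebraMap R T x ^ d * t ∈ I.map (algebraMap R T) := Iff.rfl

theorem Tr.map_eq (P : Par x y) (D : Tr x y z) {I : Ideal R} {d : ℕ}
    (hI : I ≤ maximalIdeal R ^ d) :
    I.map (algebraMap R T) = Ideal.span {algebraMap R T x ^ d} * trf T x I d := by
  apply le_antisymm
  · intro t ht
    have h1 := D.map_pow P d (Ideal.map_mono hI ht)
    obtain ⟨s, rfl⟩ := Ideal.mem_span_singleton.1 h1
    exact Ideal.mul_mem_mul (Ideal.mem_span_singleton_self _) ht
  · intro t ht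
    obtain ⟨s, hs, rfl⟩ := Ideal.mem_span_singleton_mul.1 ht
    exact hs

theorem Tr.ideal_den [IsNoetherianRing T] (P : Par x y) (D : Tr x y z) (N : Ideal T) :
    ∃ (L : ℕ) (n : Ideal R), n.map (algebraMap R T) = Ideal.span {algebraMap R T x ^ L} * N := by
  refine Submodule.fg_induction (motive := fun N _ => ∃ (L : ℕ) (n : Ideal R),
    n.map (algebraMap R T) = Ideal.span {algebraMap R T x ^ L} * N) ?_ ?_ N (IsNoetherian.noetherian N)
  · intro t
    obtain ⟨L, q, v, ε, hq, hv, hε, e, f⟩ := D.den P (J := ⊤) (t := t)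
      (by rw [Ideal.map_top]; trivial)
    refine ⟨L, Ideal.span {v}, ?_⟩
    rw [Ideal.map_span, Set.image_singleton, ← f, e]
    change _ = _ * Ideal.span {t}
    rw [Ideal.span_singleton_mul_span_singleton, mul_assoc, mul_comm ε, ← mul_assoc,
      Ideal.span_singleton_mul_right_unit hε]
  · rintro N₁ N₂ _ _ ⟨L₁, n₁, e₁⟩ ⟨L₂, n₂, e₂⟩
    refine ⟨L₁ + L₂, Ideal.span {x ^ L₂} * n₁ ⊔ Ideal.span {x ^ L₁} * n₂, ?_⟩
    rw [Ideal.map_sup, Ideal.map_mul, Ideal.map_mul, e₁, e₂, Ideal.map_span, Ideal.map_span,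
      Set.image_singleton, Set.image_singleton, ← mul_assoc, ← mul_assoc,
      Ideal.span_singleton_mul_span_singleton, Ideal.span_singleton_mul_span_singleton,
      _root_.map_pow, _root_.map_pow, ← pow_add, ← pow_add, add_comm L₂ L₁, ← Ideal.mul_sup]

theorem Tr.uniform [IsDomain T] [IsNoetherianRing R] (P : Par x y) (D : Tr x y z)
    {I n : Ideal R} {p : R} {L₀ : ℕ}
    (h : ∀ a ∈ n, algebraMap R T (p * a) ∈
      Ideal.span {algebraMap R T x ^ L₀} * (I * n).map (algebraMap R T)) (n' : Ideal R) :
    n' ≤ n → ∃ (L : ℕ) (q : R) (ε : T), q ∈ maximalIdeal R ^ L ∧ IsUnit ε ∧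
      algebraMap R T q = algebraMap R T x ^ L * ε ∧
      ∀ a ∈ n', q * p * a ∈ I * maximalIdeal R ^ (L₀ + L) * n := by
  refine Submodule.fg_induction (motive := fun n' _ => n' ≤ n →
    ∃ (L : ℕ) (q : R) (ε : T), q ∈ maximalIdeal R ^ L ∧ IsUnit ε ∧
      algebraMap R T q = algebraMap R T x ^ L * ε ∧
      ∀ a ∈ n', q * p * a ∈ I * maximalIdeal R ^ (L₀ + L) * n)
      ?_ ?_ n' (IsNoetherian.noetherian n')
  · intro a ha
    obtain ⟨s, hs, e⟩ := Ideal.mem_span_singleton_mul.1 (h a (ha (Submodule.mem_span_singleton_self a)))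
    obtain ⟨L, q, v, ε, hq, hv, hε, e', f⟩ := D.den P hs
    refine ⟨L, q, ε, hq, hε, e', ?_⟩
    intro b hb
    obtain ⟨c, rfl⟩ := Submodule.mem_span_singleton.1 hb
    have h1 : q * p * a = x ^ L₀ * v := by
      apply D.inj
      rw [mul_assoc, _root_.map_mul, ← e, _root_.map_mul, ← f, _root_.map_pow]; ring
    rw [smul_eq_mul, show q * p * (c * a) = c * (q * p * a) by ring, h1]
    refine Ideal.mul_mem_left _ _ ?_
    have h2 := Ideal.mul_mem_mul (Ideal.pow_mem_pow P.xm L₀) hv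
    convert h2 using 1
    rw [pow_add]; ring
  · intro N₁ N₂ _ _ h₁ h₂ hN
    obtain ⟨L₁, q₁, ε₁, hq₁, hε₁, e₁, f₁⟩ := h₁ (le_sup_left.trans hN)
    obtain ⟨L₂, q₂, ε₂, hq₂, hε₂, e₂, f₂⟩ := h₂ (le_sup_right.trans hN)
    refine ⟨L₁ + L₂, q₁ * q₂, ε₁ * ε₂, ?_, hε₁.mul hε₂, ?_, ?_⟩
    · rw [pow_add]; exact Ideal.mul_mem_mul hq₁ hq₂
    · rw [_root_.map_mul, e₁, e₂]; ring
    · intro a ha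
      obtain ⟨a₁, h₁, a₂, h₂, rfl⟩ := Submodule.mem_sup.1 ha
      rw [show q₁ * q₂ * p * (a₁ + a₂) = q₂ * (q₁ * p * a₁) + q₁ * (q₂ * p * a₂) by ring]
      refine add_mem ?_ ?_
      · convert Ideal.mul_mem_mul hq₂ (f₁ _ h₁) using 1
        simp only [pow_add]; ring
      · convert Ideal.mul_mem_mul hq₁ (f₂ _ h₂) using 1
        simp only [pow_add]; ring

theorem Tr.cpl [IsDomain R] [IsDomain T] [IsNoetherianRing R] [IsNoetherianRing T] (P : Par x y)
    (D : Tr x y z) {I : Ideal R} {r : ℕ} (hD : Dir x y I r) (hI : Cpl I) :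
    Cpl (trf T x I (r + 1)) := by
  rintro t ⟨N, hN, hN'⟩
  rw [mem_trf]
  set X₁ := algebraMap R T x with hX
  have hX0 : X₁ ≠ 0 := D.x_ne P
  have h1 : ∀ n ∈ N, X₁ ^ (r + 1) * t * n ∈ I.map (algebraMap R T) * N := by
    intro n hn
    rw [D.map_eq P hD.1, mul_assoc, mul_assoc]
    exact Ideal.mul_mem_mul (Ideal.mem_span_singleton_self _) (hN' n hn)
  obtain ⟨Ln, n, en⟩ := D.ideal_den P N
  set τ := X₁ ^ (r + 1) * t
  obtain ⟨L₀, q₀, p, ε₀, hq₀, hp, hε₀, e₀, f₀⟩ := D.den P (J := ⊤) (t := τ)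
      (by rw [Ideal.map_top]; trivial)
  have hn0 : n ≠ ⊥ := by
    rintro rfl
    rw [Ideal.map_bot] at en
    have := en.symm
    rw [← Ideal.zero_eq_bot, mul_eq_zero, Ideal.zero_eq_bot, Ideal.span_singleton_eq_bot] at this
    rcases this with h | h
    · exact pow_ne_zero _ hX0 h
    · exact hN h
  have h2 : ∀ a ∈ n, algebraMap R T (p * a) ∈
      Ideal.span {algebraMap R T x ^ L₀} * (I * n).map (algebraMap R T) := by
    intro a ha
    have h3 := Ideal.mem_map_of_mem (algebraMap R T) ha
    rw [en] at h3
    obtain ⟨b, hb, e⟩ := Ideal.mem_span_singleton_mul.1 h3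
    rw [_root_.map_mul, ← f₀, e₀, ← e, Ideal.map_mul, en]
    rw [show X₁ ^ L₀ * ε₀ * τ * (X₁ ^ Ln * b) = X₁ ^ L₀ * (ε₀ * (X₁ ^ Ln * (τ * b))) by ring]
    refine Ideal.mul_mem_mul (Ideal.mem_span_singleton_self _) (Ideal.mul_mem_left _ _ ?_)
    rw [mul_left_comm]
    exact Ideal.mul_mem_mul (Ideal.mem_span_singleton_self _) (h1 b hb)
  obtain ⟨L, q, ε, hq, hε, e, f⟩ := D.uniform P h2 n le_rfl
  have h3 : q * p ∈ I * maximalIdeal R ^ (L₀ + L) :=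
    P.cpl_mul_pow hD hI (L₀ + L) _ ⟨n, hn0, f⟩
  have h4 := D.map_mul_pow P I _ (Ideal.mem_map_of_mem (algebraMap R T) h3)
  rw [_root_.map_mul, e, ← f₀, e₀, show X₁ ^ L * ε * (X₁ ^ L₀ * ε₀ * τ) =
    X₁ ^ (L₀ + L) * (ε * ε₀ * τ) by ring] at h4
  have h5 := mem_of_mul_mem_span_mul (pow_ne_zero _ hX0) h4
  exact (Ideal.unit_mul_mem_iff_mem _ (hε.mul hε₀)).1 h5

theorem Tr.monic [IsDomain R] (P : Par x y) (D : Tr x y z) {I : Ideal R} {r : ℕ}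
    (hD : Dir x y I r) : ∃ Q : R[X], Q.Monic ∧ Q.natDegree = r + 1 ∧
      aeval z Q ∈ trf T x I (r + 1) := by
  obtain ⟨-, u, w, hu, hw, hf⟩ := hD
  obtain ⟨W, hW, e⟩ := P.toPoly D.hz r hw
  obtain ⟨u, rfl⟩ := hu
  have hd : (C (↑u⁻¹ : R) * W).degree < ((r + 1 : ℕ) : WithBot ℕ) := by
    refine lt_of_le_of_lt degree_le_natDegree ?_
    have := (natDegree_C_mul_le (↑u⁻¹ : R) W).trans hW
    exact_mod_cast Nat.lt_succ_of_le this
  refine ⟨X ^ (r + 1) + C (↑u⁻¹ : R) * W, monic_X_pow_add hd, ?_, ?_⟩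
  · rw [natDegree_add_eq_left_of_degree_lt (by simpa using hd), natDegree_X_pow]
  · rw [mem_trf]
    have h1 := Ideal.mul_mem_left _ (algebraMap R T (↑u⁻¹ : R))
      (Ideal.mem_map_of_mem (algebraMap R T) hf)
    convert h1 using 1
    have h2 : algebraMap R T (↑u⁻¹ : R) * algebraMap R T ↑u = 1 := by
      rw [← _root_.map_mul]; simp
    simp only [_root_.map_add, _root_.map_mul, _root_.map_pow, aeval_X, aeval_C, e, ← D.hz]
    linear_combination (-(algebraMap R T x * z) ^ (r + 1)) * h2

theorem Tr.x_mem (P : Par x y) (D : Tr x y z) {I : Ideal R} {d k : ℕ} [IsDomain R] [IsDomain T]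
    (hk : maximalIdeal R ^ k ≤ I) (hT : trf T x I d ≠ ⊤) :
    algebraMap R T x ∈ maximalIdeal T := by
  have h1 : algebraMap R T x ^ k ∈ trf T x I d := by
    rw [mem_trf]
    refine Ideal.mul_mem_left _ _ ?_
    rw [← _root_.map_pow]
    exact Ideal.mem_map_of_mem _ (hk (Ideal.pow_mem_pow P.xm k))
  exact (maximalIdeal.isMaximal T).isPrime.mem_of_pow_mem _ (le_maximalIdeal hT h1)

theorem Tr.root [IsDomain R] [IsAlgClosed (ResidueField R)] (P : Par x y) (D : Tr x y z)
    (hx : algebraMap R T x ∈ maximalIdeal T) {Q : R[X]} (hQ : Q.Monic)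
    (h : aeval z Q ∈ maximalIdeal T) : ∃ a : R, z - algebraMap R T a ∈ maximalIdeal T := by
  have := D.isLocalHom P hx
  letI : Algebra (ResidueField R) (ResidueField T) := (ResidueField.map (algebraMap R T)).toAlgebra
  have hi : IsIntegral (ResidueField R) (residue T z) := by
    refine ⟨Q.map (residue R), hQ.map _, ?_⟩
    rw [eval₂_map]
    have h1 : (algebraMap (ResidueField R) (ResidueField T)).comp (residue R) =
        (residue T).comp (algebraMap R T) := by
      ext a; exact ResidueField.map_residue _ _
    rw [h1, ← hom_eval₂, residue_eq_zero_iff]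
    exact h
  have h1 := IsAlgClosed.degree_eq_one_of_irreducible _ (minpoly.irreducible hi)
  obtain ⟨b, hb⟩ := minpoly.mem_range_of_degree_eq_one _ _ h1
  obtain ⟨a, rfl⟩ := residue_surjective b
  refine ⟨a, ?_⟩
  rw [← residue_eq_zero_iff, map_sub, sub_eq_zero, ← hb]
  exact ResidueField.map_residue _ _

theorem Tr.phi_lt [IsDomain R] [IsDomain T] (P : Par x y) (D : Tr x y z) {d : ℕ} {Q : R[X]}
    (hQ : Q.Monic) (hd : Q.natDegree = d) {A B : Ideal T} (hA : aeval z Q ∈ A) (h : A < B) :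
    (Ideal.span {algebraMap R T x ^ d} * A).comap (algebraMap R T) <
    (Ideal.span {algebraMap R T x ^ d} * B).comap (algebraMap R T) := by
  refine lt_of_le_not_ge (Ideal.comap_mono (Ideal.mul_mono_right h.le)) fun hle => ?_
  obtain ⟨b, hb, hbA⟩ := SetLike.exists_of_lt h
  obtain ⟨H, G, hH, e⟩ := D.frac b
  have h1 := P.ofPoly D.hz (G %ₘ Q) (L := d) (hd ▸ natDegree_modByMonic_le _ hQ)
  set g := ∑ i ∈ Finset.range (d + 1), (G %ₘ Q).coeff i * (x ^ (d - i) * y ^ i)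
  have h2 : aeval z (G %ₘ Q) = aeval z H * b - aeval z (G /ₘ Q) * aeval z Q := by
    have := congrArg (aeval z) (modByMonic_add_div G Q)
    rw [_root_.map_add, _root_.map_mul] at this
    rw [e, ← this]; ring
  have h3 : g ∈ (Ideal.span {algebraMap R T x ^ d} * B).comap (algebraMap R T) := by
    rw [Ideal.mem_comap, h1]
    refine Ideal.mul_mem_mul (Ideal.mem_span_singleton_self _) ?_
    rw [h2]
    exact sub_mem (Ideal.mul_mem_left _ _ hb) (Ideal.mul_mem_left _ _ (h.le hA))
  have h4 := hle h3
  rw [Ideal.mem_comap, h1] at h4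
  have h5 := mem_of_mul_mem_span_mul (pow_ne_zero _ (D.x_ne P)) h4
  rw [h2] at h5
  have h6 := add_mem h5 (Ideal.mul_mem_left _ (aeval z (G /ₘ Q)) hA)
  rw [sub_add_cancel] at h6
  exact hbA ((Ideal.unit_mul_mem_iff_mem _ hH).1 h6)

theorem Tr.bd [IsDomain R] [IsDomain T] (P : Par x y) (D : Tr x y z) {I : Ideal R} {r m : ℕ}
    (hD : Dir x y I r) (hx : algebraMap R T x ∈ maximalIdeal T) (hb : Bd I (m + 1)) :
    Bd (trf T x I (r + 1)) m := by
  intro n c h0 hc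
  obtain ⟨Q, hQ, hd, hz⟩ := D.monic P hD
  have h1 : ∀ i ≤ n, trf T x I (r + 1) ≤ c i := by
    intro i
    induction i with
    | zero => intro _; exact h0
    | succ i ih => intro hi; exact (ih (by omega)).trans (hc i (by omega)).le
  have := hb (n + 1) (fun i => if i ≤ n then
    (Ideal.span {algebraMap R T x ^ (r + 1)} * c i).comap (algebraMap R T) else ⊤) ?_ ?_
  · omega
  · simp only [Nat.zero_le, if_true]
    rw [← Ideal.map_le_iff_le_comap, D.map_eq P hD.1]
    exact Ideal.mul_mono_right h0
  · intro i hi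
    rcases Nat.lt_or_ge i n with h | h
    · simp only [if_pos h.le, if_pos (show i + 1 ≤ n from h)]
      exact D.phi_lt P hQ hd (h1 i h.le hz) (hc i h)
    · obtain rfl : i = n := by omega
      simp only [le_refl, if_true, if_neg (show ¬ i + 1 ≤ i by omega)]
      rw [lt_top_iff_ne_top, Ne, Ideal.comap_eq_top_iff]
      intro h2
      have h3 : Ideal.span {algebraMap R T x ^ (r + 1)} * c i ≤ maximalIdeal T := by
        refine Ideal.mul_le_left.trans ?_
        rw [Ideal.span_singleton_le_iff_mem]
        exact Ideal.pow_mem_of_mem _ hx _ (by omega)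
      rw [h2] at h3
      exact (maximalIdeal.isMaximal T).ne_top (top_le_iff.1 h3)

end tr2
end ZarC

namespace ZarC

section glob
open Polynomial
universe u
variable {R : Type u} [CommRing R] [IsLocalRing R]
variable {S : Type u} [CommRing S] [Algebra R S]
variable {x y : R} {z : S}

theorem chart_back (P : Par x y) (hz : algebraMap R S x * z = algebraMap R S y)
    (hs : ∀ s : S, ∃ G : R[X], s = aeval z G) {J : Ideal R} {t : S}
    (ht : t ∈ J.map (algebraMap R S)) :
    ∃ (L : ℕ) (v : R), v ∈ J * maximalIdeal R ^ L ∧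
      algebraMap R S x ^ L * t = algebraMap R S v := by
  refine Submodule.span_induction (p := fun t _ => ∃ (L : ℕ) (v : R),
      v ∈ J * maximalIdeal R ^ L ∧
      algebraMap R S x ^ L * t = algebraMap R S v) ?_ ?_ ?_ ?_ ht
  · rintro _ ⟨j, hj, rfl⟩
    exact ⟨0, j, by simpa using hj, by simp⟩
  · exact ⟨0, 0, zero_mem _, by simp⟩
  · rintro a b _ _ ⟨L₁, v₁, hv₁, f₁⟩ ⟨L₂, v₂, hv₂, f₂⟩
    refine ⟨L₁ + L₂, v₁ * x ^ L₂ + v₂ * x ^ L₁, ?_, ?_⟩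
    · refine add_mem ?_ ?_
      · rw [pow_add, ← mul_assoc]; exact Ideal.mul_mem_mul hv₁ (Ideal.pow_mem_pow P.xm _)
      · rw [add_comm, pow_add, ← mul_assoc]
        exact Ideal.mul_mem_mul hv₂ (Ideal.pow_mem_pow P.xm _)
    · simp only [map_mul, map_add, map_pow, ← f₁, ← f₂]; ring
  · rintro a t _ ⟨L, v, hv, f⟩
    obtain ⟨G, rfl⟩ := hs a
    have h2 := P.ofPoly hz G le_rfl
    have h4 := P.ofPoly_mem G G.natDegree
    refine ⟨L + G.natDegree, v * ∑ i ∈ Finset.range (G.natDegree + 1),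
      G.coeff i * (x ^ (G.natDegree - i) * y ^ i), ?_, ?_⟩
    · rw [pow_add, ← mul_assoc]; exact Ideal.mul_mem_mul hv h4
    · rw [map_mul, ← f, h2, smul_eq_mul]; ring

theorem chart_tr [IsDomain S] (hinj : Function.Injective (algebraMap R S))
    (hz : algebraMap R S x * z = algebraMap R S y)
    (hs : ∀ s : S, ∃ G : R[X], s = aeval z G) (N : Ideal S) [N.IsPrime] :
    Tr (T := Localization.AtPrime N) x y (algebraMap S (Localization.AtPrime N) z) := by
  refine ⟨?_, ?_, ?_⟩
  · rw [IsScalarTower.algebraMap_eq R S]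
    exact (IsLocalization.injective (Localization.AtPrime N)
      N.primeCompl_le_nonZeroDivisors).comp hinj
  · rw [IsScalarTower.algebraMap_apply R S (Localization.AtPrime N) x,
      IsScalarTower.algebraMap_apply R S (Localization.AtPrime N) y, ← map_mul, hz]
  · intro t
    obtain ⟨s, s', rfl⟩ := IsLocalization.exists_mk'_eq N.primeCompl t
    obtain ⟨G, hG⟩ := hs s
    obtain ⟨H, hH⟩ := hs s'
    refine ⟨H, G, ?_, ?_⟩
    · rw [aeval_algebraMap_apply, ← hH]
      exact IsLocalization.map_units _ s'
    · rw [aeval_algebraMap_apply, aeval_algebraMap_apply, ← hH, ← hG, mul_comm]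
      exact IsLocalization.mk'_spec _ _ _

theorem mem_of_local {J : Ideal S} {g : S}
    (h : ∀ (N : Ideal S) [N.IsMaximal], algebraMap S (Localization.AtPrime N) g ∈
      J.map (algebraMap S (Localization.AtPrime N))) : g ∈ J := by
  by_contra hg
  have h1 : Submodule.comap (LinearMap.mulRight S g) J ≠ ⊤ := by
    intro h1
    have : (1 : S) ∈ Submodule.comap (LinearMap.mulRight S g) J := by rw [h1]; trivial
    rw [Submodule.mem_comap] at this
    simp at this
    exact hg this
  obtain ⟨N, hN, hle⟩ := Ideal.exists_le_maximal _ h1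
  have h2 := h N
  rw [IsLocalization.algebraMap_mem_map_algebraMap_iff N.primeCompl] at h2
  obtain ⟨s, hs, hs'⟩ := h2
  exact hs (hle hs')

/-- the local step -/
theorem local_step {T : Type u} [CommRing T] [IsLocalRing T] [Algebra R T] {z : T} [IsDomain R]
    [IsDomain T] [IsNoetherianRing R] [IsNoetherianRing T] (P : Par x y) (D : Tr x y z)
    {I : Ideal R} {r n : ℕ} (hD : Dir x y I r)
    (hT : Cpl (trf T x I (r + 1) ^ n)) {g : R} (hg : IC (I ^ n) g) :
    algebraMap R T g ∈ (I ^ n).map (algebraMap R T) := by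
  have h1 : I ^ n ≤ maximalIdeal R ^ ((r + 1) * n) := by
    rw [pow_mul]; exact Ideal.pow_right_mono hD.1 n
  have h2 : g ∈ maximalIdeal R ^ ((r + 1) * n) := by
    obtain ⟨N, h0, hN⟩ := hg
    exact P.cpl_pow _ g ⟨N, h0, fun a ha => Ideal.mul_mono_left h1 (hN a ha)⟩
  obtain ⟨t, ht⟩ := Ideal.mem_span_singleton.1
    (D.map_pow P _ (Ideal.mem_map_of_mem (algebraMap R T) h2))
  have h3 : (I ^ n).map (algebraMap R T) =
      Ideal.span {algebraMap R T x ^ ((r + 1) * n)} * trf T x I (r + 1) ^ n := by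
    rw [Ideal.map_pow, D.map_eq P hD.1, mul_pow, Ideal.span_singleton_pow, pow_mul]
  rw [h3, ht]
  refine Ideal.mul_mem_mul (Ideal.mem_span_singleton_self _) (hT _ ?_)
  obtain ⟨N, h0, hN⟩ := hg
  refine ⟨N.map (algebraMap R T), ?_, ?_⟩
  · intro h
    rw [Ideal.map_eq_bot_iff_of_injective D.inj] at h
    exact h0 h
  · intro a ha
    have h4 : algebraMap R T g * a ∈ (I ^ n * N).map (algebraMap R T) := by
      refine Submodule.span_induction (p := fun a _ => algebraMap R T g * a ∈
        (I ^ n * N).map (algebraMap R T)) ?_ ?_ ?_ ?_ ha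
      · rintro _ ⟨j, hj, rfl⟩
        rw [← map_mul]
        exact Ideal.mem_map_of_mem _ (hN j hj)
      · simp
      · intro b c _ _ hb hc; rw [mul_add]; exact add_mem hb hc
      · intro b c _ hc
        rw [smul_eq_mul, mul_left_comm]; exact Ideal.mul_mem_left _ _ hc
    rw [Ideal.map_mul, h3, ht, mul_assoc, mul_assoc] at h4
    exact mem_of_mul_mem_span_mul (pow_ne_zero _ (D.x_ne P)) h4

theorem cpl_top : Cpl (⊤ : Ideal S) := fun _ _ => trivial

theorem exists_chart [IsDomain R] [IsNoetherianRing R] (P : Par x y) :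
    ∃ (S : Type u) (_ : CommRing S) (_ : IsDomain S) (_ : IsNoetherianRing S) (_ : Algebra R S)
      (z : S), Function.Injective (algebraMap R S) ∧
      algebraMap R S x * z = algebraMap R S y ∧ ∀ s : S, ∃ G : R[X], s = aeval z G := by
  let K := FractionRing R
  let w : K := algebraMap R K y / algebraMap R K x
  let S := (aeval (R := R) w).range
  have hN : IsNoetherianRing S := inferInstanceAs (IsNoetherianRing (aeval (R := R) w).range)
  let z : S := ⟨w, X, by simp⟩
  refine ⟨S, inferInstance, inferInstance, hN, inferInstance, z, ?_, ?_, ?_⟩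
  · intro a b h
    exact IsFractionRing.injective R K (congrArg Subtype.val h)
  · apply Subtype.ext
    change algebraMap R K x * (algebraMap R K y / algebraMap R K x) = algebraMap R K y
    refine mul_div_cancel₀ _ ?_
    intro h
    exact P.px.ne_zero (IsFractionRing.injective R K (h.trans (map_zero _).symm))
  · rintro ⟨_, G, rfl⟩
    refine ⟨G, Subtype.ext ?_⟩
    change aeval w G = S.val (aeval z G)
    rw [← aeval_algHom_apply]
    rfl

theorem main : ∀ (m : ℕ) (R : Type u) [CommRing R] [IsLocalRing R] [IsDomain R]
    [IsNoetherianRing R] [IsAlgClosed (ResidueField R)] (_ : 1 < (maximalIdeal R).height)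
    (x y : R) (_ : maximalIdeal R = Ideal.span {x, y}) (I : Ideal R), Bd I m → Cpl I →
    ∀ n : ℕ, Cpl (I ^ n) := by
  intro m
  induction m with
  | zero =>
    intro R _ _ _ _ _ hh x y hs I hb hI n
    have : I = ⊤ := by
      have := hb.pow_le
      simpa using this
    rw [this, Ideal.top_pow]
    exact cpl_top
  | succ m ih =>
    intro R _ _ _ _ _ hh x₀ y₀ hs₀ I hb hI n
    by_cases htop : I = ⊤
    · rw [htop, Ideal.top_pow]; exact cpl_top
    have hM0 : maximalIdeal R ≠ ⊥ := by
      intro h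
      rw [h] at hh
      simp at hh
    have hI0 : I ≠ ⊥ := by
      rintro rfl
      have h1 := le_bot_iff.1 hb.pow_le
      rw [← Ideal.zero_eq_bot] at h1
      exact hM0 (eq_zero_of_pow_eq_zero h1)
    obtain ⟨s, hs1, hs2⟩ := exists_order hI0
    obtain ⟨r, rfl⟩ : ∃ r, s = r + 1 := by
      refine Nat.exists_eq_succ_of_ne_zero ?_
      rintro rfl
      exact hs2 (by simpa using le_maximalIdeal htop)
    have : Infinite (ResidueField R) := IsAlgClosed.instInfinite
    obtain ⟨x, y, P, hD⟩ := exists_dir hh hs₀ hs1 hs2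
    intro g hg
    obtain ⟨S, _, _, _, _, z, hinj, hz, hsur⟩ := exists_chart P
    have h1 : algebraMap R S g ∈ (I ^ n).map (algebraMap R S) := by
      refine mem_of_local fun N _ => ?_
      have D := chart_tr hinj hz hsur N
      rw [Ideal.map_map, ← IsScalarTower.algebraMap_eq, ← IsScalarTower.algebraMap_apply]
      have : IsNoetherianRing (Localization.AtPrime N) :=
        IsLocalization.isNoetherianRing N.primeCompl _ inferInstance
      have : IsDomain (Localization.AtPrime N) := inferInstance
      refine local_step P D hD ?_ hg
      by_cases ht : trf (Localization.AtPrime N) x I (r + 1) = ⊤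
      · rw [ht, Ideal.top_pow]; exact cpl_top
      have hx := D.x_mem P hb.pow_le ht
      obtain ⟨Q, hQ, -, hQz⟩ := D.monic P hD
      obtain ⟨a, ha⟩ := D.root P hx hQ (le_maximalIdeal ht hQz)
      have := D.algClosed P hx ha
      exact ih _ (D.height P hx ha) _ _ (D.span P hx ha) _ (D.bd P hD hx hb) (D.cpl P hD hI) n
    obtain ⟨L, v, hv, e⟩ := chart_back P hz hsur h1
    rw [← map_pow, ← map_mul] at e
    have h2 := hinj e
    exact P.con_contract (P.con_pow (P.con_of_cpl hD hI) n) L (h2 ▸ hv)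

end glob

theorem final
    (R : Type*) [CommRing R] [IsLocalRing R] [IsNoetherianRing R]
    (hdim : ringKrullDim R = 2)
    (hreg : ∃ x y : R, maximalIdeal R = Ideal.span {x, y})
    [IsAlgClosed (ResidueField R)]
    (I : Ideal R) (hIc : I.IsComplete) (hIp : I.IsMPrimary) :
    ∀ n : ℕ, 0 < n → (I ^ n).IsComplete := by
  intro n _
  obtain ⟨x, y, hs⟩ := hreg
  have hh : 1 < (maximalIdeal R).height := by
    have h1 := maximalIdeal_height_eq_ringKrullDim (R := R)
    rw [hdim] at h1
    have h2 : (maximalIdeal R).height = 2 := WithBot.coe_injective (h1.trans rfl)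
    rw [h2]; norm_num
  have := isDomain_of_height hh hs
  obtain ⟨k, hk⟩ := Ideal.exists_radical_pow_le_of_fg I (IsNoetherian.noetherian _)
  rw [show I.radical = _ from hIp] at hk
  obtain ⟨m, hm⟩ := exists_bd hk
  rw [cpl_iff] at hIc ⊢
  exact main m R hh x y hs I hm hIc n

end ZarC

/-- Let `(R, M)` be a two-dimensional regular local ring with algebraically closed residue
field.  Then every complete `M`-primary ideal `I` of `R` is normal, i.e. every power `I ^ n`
is complete (integrally closed). -/
theorem complete_mPrimary_isNormal
    (R : Type*) [CommRing R] [IsLocalRing R] [IsNoetherianRing R]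
    (hdim : ringKrullDim R = 2)
    (hreg : ∃ x y : R, maximalIdeal R = Ideal.span {x, y})
    [IsAlgClosed (ResidueField R)]
    (I : Ideal R) (hIc : I.IsComplete) (hIp : I.IsMPrimary) :
    ∀ n : ℕ, 0 < n → (I ^ n).IsComplete := by
  exact ZarC.final R hdim hreg I hIc hIp
end

section
/- Let (R,M) be a two-dimensional regular local ring with algebraically closed residue field k. Then every complete M-primary ideal I of R is minimally generated, i.e., the minimal number of generators satisfies mu(I) = ord_R(I) + 1 = dim_k(M^r/M^{r+1}) where r = ord_R(I). -/
open IsLocalRing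

/-- The minimal number of generators of an ideal. -/
noncomputable def mu {R : Type*} [CommRing R] (I : Ideal R) : ℕ :=
  sInf {n : ℕ | ∃ s : Finset R, s.card = n ∧ Ideal.span (s : Set R) = I}

/-- The length of a module: the supremum of the lengths of strictly increasing chains of
submodules.  For a module annihilated by the maximal ideal of a local ring this is the
dimension of the module as a vector space over the residue field. -/
noncomputable def moduleLength (R M : Type*) [CommRing R] [AddCommGroup M] [Module R M] : ℕ∞ :=
  ⨆ (n : ℕ) (_ : ∃ c : Fin (n + 1) → Submodule R M, StrictMono c), (n : ℕ∞)

/-- The quotient module `E / F` of two ideals `F ≤ E` of `R`. -/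
abbrev idealQuot {R : Type*} [CommRing R] (E F : Ideal R) :=
  E ⧸ (Submodule.comap E.subtype F)

section Helpers

set_option linter.unusedSectionVars false

variable {R : Type*} [CommRing R] [IsLocalRing R] [IsNoetherianRing R]

lemma aux_pow_le {x y : R} (hM : maximalIdeal R = Ideal.span {x, y}) (n : ℕ) :
    maximalIdeal R ^ n ≤ Ideal.span {x} * maximalIdeal R ^ (n - 1) ⊔ Ideal.span {y ^ n} := by
  induction n with
  | zero => simp
  | succ n ih =>
    have h0 : maximalIdeal R * maximalIdeal R ^ n =
        Ideal.span {x} * maximalIdeal R ^ n ⊔ Ideal.span {y} * maximalIdeal R ^ n := by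
      rw [← Ideal.sup_mul, ← Ideal.span_insert, ← hM]
    rw [pow_succ', Nat.add_sub_cancel, h0]
    refine sup_le le_sup_left ?_
    refine (Ideal.mul_mono_right ih).trans ?_
    rw [Ideal.mul_sup, Ideal.span_singleton_mul_span_singleton, ← pow_succ']
    refine sup_le_sup_right ?_ _
    rw [mul_left_comm]
    refine Ideal.mul_mono_right ?_
    have hy : Ideal.span {y} ≤ maximalIdeal R := by
      rw [hM]; exact Ideal.span_mono (by simp)
    refine (Ideal.mul_mono_left hy).trans ?_
    rw [← pow_succ']
    exact Ideal.pow_le_pow_right (by omega)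

lemma aux_notMem (hdim : ringKrullDim R = 2) {x y : R}
    (hM : maximalIdeal R = Ideal.span {x, y}) (n : ℕ) :
    y ^ n ∉ Ideal.span {x} ⊔ maximalIdeal R ^ (n + 1) := by
  intro h
  have hy : y ∈ maximalIdeal R := by rw [hM]; exact Ideal.subset_span (by simp)
  have h1 : y ^ n ∈ Ideal.span {x} ⊔ Ideal.span {y ^ (n + 1)} := by
    refine (sup_le le_sup_left ((aux_pow_le hM (n+1)).trans ?_)) h
    exact sup_le_sup_right Ideal.mul_le_left _
  obtain ⟨a, ha, b, hb, hab⟩ := Submodule.mem_sup.1 h1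
  obtain ⟨c, rfl⟩ := Ideal.mem_span_singleton'.1 hb
  have hu : IsUnit (1 - c * y) := by
    by_contra hn
    have h2 := (mem_maximalIdeal (R := R) _).2 hn
    have h3 : (1 : R) ∈ maximalIdeal R := by
      have := add_mem h2 (Ideal.mul_mem_left _ c hy)
      rwa [sub_add_cancel] at this
    exact (Ideal.ne_top_iff_one _).1 (maximalIdeal.isMaximal R).ne_top h3
  have h4 : y ^ n ∈ Ideal.span {x} := by
    rw [← Ideal.unit_mul_mem_iff_mem _ hu]
    convert ha using 1
    rw [← sub_eq_zero] at hab
    linear_combination (-1 : R) * hab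
  have h5 : maximalIdeal R ∈ (Ideal.span {x}).minimalPrimes := by
    refine ⟨⟨inferInstance, ?_⟩, ?_⟩
    · rw [hM]; exact Ideal.span_mono (by simp)
    · rintro q ⟨hq, hxq⟩ _
      rw [hM, Ideal.span_le]
      rintro z (rfl | rfl)
      · exact hxq (Ideal.mem_span_singleton_self _)
      · exact hq.mem_of_pow_mem n (hxq h4)
  have h6 := Ideal.height_le_one_of_isPrincipal_of_mem_minimalPrimes _ _ h5
  have h7 := IsLocalRing.maximalIdeal_height_eq_ringKrullDim (R := R)
  rw [hdim] at h7
  have h8 : (maximalIdeal R).height = 2 := WithBot.coe_injective h7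
  rw [h8] at h6
  exact absurd h6 (by decide)

lemma aux_rep {x y : R} (hM : maximalIdeal R = Ideal.span {x, y}) (n : ℕ) :
    ∀ f ∈ maximalIdeal R ^ n, ∃ a : ℕ → R,
      f = ∑ i ∈ Finset.range (n + 1), a i * (x ^ i * y ^ (n - i)) := by
  induction n with
  | zero => intro f _; exact ⟨fun _ => f, by simp⟩
  | succ n ih =>
    intro f hf
    have h1 := aux_pow_le hM (n+1) hf
    obtain ⟨u, hu, v, hv, rfl⟩ := Submodule.mem_sup.1 h1
    obtain ⟨c, rfl⟩ := Ideal.mem_span_singleton'.1 hv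
    obtain ⟨w, hw, rfl⟩ := Ideal.mem_span_singleton_mul.1 hu
    obtain ⟨a, rfl⟩ := ih w (by simpa using hw)
    refine ⟨fun i => if i = 0 then c else a (i - 1), ?_⟩
    rw [Finset.sum_range_succ' _ (n + 1), Finset.mul_sum]
    congr 1
    · refine Finset.sum_congr rfl fun i _ => ?_
      simp [pow_succ]; ring
    · simp

/-- specialisation of an initial form -/
lemma aux_spec {x y : R} (hM : maximalIdeal R = Ideal.span {x, y}) (n : ℕ)
    {f : R} (hf : f ∈ maximalIdeal R ^ n) (hf' : f ∉ maximalIdeal R ^ (n + 1)) :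
    ∃ F : Polynomial (ResidueField R), F ≠ 0 ∧ ∀ t : R, F.eval (residue R t) ≠ 0 →
      ∃ c : R, IsUnit c ∧ f - c * y ^ n ∈ Ideal.span {x - t * y} := by
  obtain ⟨a, rfl⟩ := aux_rep hM n f hf
  set P : Polynomial R := ∑ i ∈ Finset.range (n + 1), Polynomial.C (a i) * Polynomial.X ^ i
    with hP
  refine ⟨P.map (residue R), ?_, ?_⟩
  · intro h0
    apply hf'
    refine sum_mem fun i hi => ?_
    have hc : P.coeff i = a i := by
      simp only [hP, Polynomial.finsetSum_coeff, Polynomial.coeff_C_mul_X_pow]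
      simp at hi ⊢
      intro h; omega
    have h1 : a i ∈ maximalIdeal R := by
      rw [← residue_eq_zero_iff, ← hc, ← Polynomial.coeff_map, h0, Polynomial.coeff_zero]
    have hx : x ∈ maximalIdeal R := by rw [hM]; exact Ideal.subset_span (by simp)
    have hy : y ∈ maximalIdeal R := by rw [hM]; exact Ideal.subset_span (by simp)
    rw [pow_succ']
    refine Ideal.mul_mem_mul h1 ?_
    have := Ideal.mul_mem_mul (Ideal.pow_mem_pow hx i) (Ideal.pow_mem_pow hy (n - i))
    rwa [← pow_add, Nat.add_sub_cancel' (by simp at hi; omega)] at this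
  · intro t ht
    refine ⟨P.eval t, ?_, ?_⟩
    · rw [Polynomial.eval_map_apply] at ht
      by_contra hn
      exact ht ((residue_eq_zero_iff _).2 ((mem_maximalIdeal (R := R) _).2 hn))
    · simp only [hP, Polynomial.eval_finsetSum, Finset.sum_mul, ← Finset.sum_sub_distrib]
      refine sum_mem fun i hi => ?_
      simp only [Polynomial.eval_mul, Polynomial.eval_C, Polynomial.eval_pow, Polynomial.eval_X]
      have : y ^ n = y ^ i * y ^ (n - i) := by
        rw [← pow_add, Nat.add_sub_cancel' (by simp at hi; omega)]
      rw [Ideal.mem_span_singleton]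
      have h2 : x - t * y ∣ x ^ i - (t * y) ^ i := sub_dvd_pow_sub_pow _ _ _
      rw [this, show a i * (x ^ i * y ^ (n - i)) - a i * t ^ i * (y ^ i * y ^ (n - i))
        = (x ^ i - (t * y) ^ i) * (a i * y ^ (n - i)) by rw [mul_pow]; ring]
      exact h2.mul_right _

lemma aux_coord {x y : R} (hM : maximalIdeal R = Ideal.span {x, y}) (t : R) :
    maximalIdeal R = Ideal.span {x - t * y, y} := by
  rw [hM]
  apply le_antisymm
  · rw [Ideal.span_le]
    rintro z (rfl | rfl)
    · exact Ideal.mem_span_pair.2 ⟨1, t, by ring⟩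
    · exact Ideal.subset_span (by simp)
  · rw [Ideal.span_le]
    rintro z (rfl | rfl)
    · exact Ideal.mem_span_pair.2 ⟨1, -t, by ring⟩
    · exact Ideal.subset_span (by simp)

lemma aux_mul [Infinite (ResidueField R)] (hdim : ringKrullDim R = 2) {x y : R}
    (hM : maximalIdeal R = Ideal.span {x, y})
    {a b : ℕ} {f g : R} (hf : f ∈ maximalIdeal R ^ a) (hf' : f ∉ maximalIdeal R ^ (a + 1))
    (hg : g ∈ maximalIdeal R ^ b) (hg' : g ∉ maximalIdeal R ^ (b + 1)) :
    f * g ∉ maximalIdeal R ^ (a + b + 1) := by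
  intro h
  obtain ⟨F, hF0, hF⟩ := aux_spec hM a hf hf'
  obtain ⟨G, hG0, hG⟩ := aux_spec hM b hg hg'
  obtain ⟨t', ht'⟩ : ∃ t, (F * G).eval t ≠ 0 := by
    by_contra! hcon
    exact (mul_ne_zero hF0 hG0) (Polynomial.funext (by simpa using hcon))
  obtain ⟨t, rfl⟩ := residue_surjective t'
  rw [Polynomial.eval_mul] at ht'
  obtain ⟨c, hc, hc'⟩ := hF t (left_ne_zero_of_mul ht')
  obtain ⟨d, hd, hd'⟩ := hG t (right_ne_zero_of_mul ht')
  apply aux_notMem hdim (aux_coord hM t) (a + b)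
  rw [← Ideal.unit_mul_mem_iff_mem _ (hc.mul hd)]
  have h1 : f * g - (c * d) * y ^ (a + b) ∈ Ideal.span {x - t * y} := by
    have := add_mem (Ideal.mul_mem_right g _ hc') (Ideal.mul_mem_left _ (c * y ^ a) hd')
    convert this using 1
    ring
  have := sub_mem (Submodule.mem_sup_right h) (Submodule.mem_sup_left h1)
  simpa using this

lemma aux_exists_order {f : R} (n : ℕ) (hf : f ∉ maximalIdeal R ^ n) :
    ∃ s < n, f ∈ maximalIdeal R ^ s ∧ f ∉ maximalIdeal R ^ (s + 1) := by
  induction n with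
  | zero => simp at hf
  | succ n ih =>
    by_cases h : f ∈ maximalIdeal R ^ n
    · exact ⟨n, by omega, h, hf⟩
    · obtain ⟨s, hs, h1⟩ := ih h
      exact ⟨s, by omega, h1⟩

lemma aux_ne_zero {f : R} (hf : f ≠ 0) : ∃ n, f ∉ maximalIdeal R ^ n := by
  by_contra! h
  apply hf
  have := Ideal.iInf_pow_eq_bot_of_isLocalRing (maximalIdeal R) (maximalIdeal.isMaximal R).ne_top
  rw [← Ideal.mem_bot, ← this]
  simpa using h

lemma aux_domain [Infinite (ResidueField R)] (hdim : ringKrullDim R = 2) {x y : R}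
    (hM : maximalIdeal R = Ideal.span {x, y}) : NoZeroDivisors R := by
  refine ⟨fun {f g} h => ?_⟩
  by_contra! hcon
  obtain ⟨n, hn⟩ := aux_ne_zero hcon.1
  obtain ⟨m, hm⟩ := aux_ne_zero hcon.2
  obtain ⟨a, -, ha, ha'⟩ := aux_exists_order n hn
  obtain ⟨b, -, hb, hb'⟩ := aux_exists_order m hm
  apply aux_mul hdim hM ha ha' hb hb'
  rw [h]; exact zero_mem _

lemma aux_colon_pow [Infinite (ResidueField R)] (hdim : ringKrullDim R = 2) {x y : R}
    (hM : maximalIdeal R = Ideal.span {x, y}) (r : ℕ) (z : R)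
    (hz : x * z ∈ maximalIdeal R ^ (r + 1)) : z ∈ maximalIdeal R ^ r := by
  by_contra hn
  obtain ⟨s, hs, h1, h2⟩ := aux_exists_order r hn
  have hx : x ∈ maximalIdeal R ^ 1 := by
    rw [pow_one, hM]; exact Ideal.subset_span (by simp)
  have hx' : x ∉ maximalIdeal R ^ (1 + 1) := fun h =>
    aux_notMem hdim (x := y) (y := x) (by rw [hM, Set.pair_comm]) 1
      (Submodule.mem_sup_right (by simpa using h))
  exact aux_mul hdim hM hx hx' h1 h2 (Ideal.pow_le_pow_right (by omega) hz)

lemma aux_det [NoZeroDivisors R] (I N : Ideal R) (hN : N ≠ ⊥) (z : R)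
    (h : ∀ w ∈ N, z * w ∈ I * N) : I.IsIntegralElemOver z := by
  obtain ⟨p, hp, -, hc, h0⟩ :=
    LinearMap.exists_monic_and_natDegree_eq_and_coeff_mem_pow_and_aeval_eq_zero R
      (algebraMap R (Module.End R N) z) I (by
        rintro _ ⟨w, rfl⟩
        rw [Submodule.mem_smul_top_iff]
        simpa using h w w.2)
  obtain ⟨w, hw, hw0⟩ := Submodule.exists_mem_ne_zero_of_ne_bot hN
  have h1 : p.eval z = 0 := by
    rw [Polynomial.aeval_algebraMap_apply] at h0
    have h2 := congrArg (fun φ : Module.End R N => ((φ ⟨w, hw⟩ : N) : R)) h0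
    simpa [hw0] using h2
  have hpos : 0 < p.natDegree := by
    rw [Nat.pos_iff_ne_zero]
    intro hd
    rw [hp.natDegree_eq_zero.1 hd] at h1
    simp at h1
  refine ⟨p.natDegree, hpos, fun i => p.coeff (p.natDegree - i), ?_, ?_⟩
  · intro i hi
    have := hc (p.natDegree - i)
    rwa [Nat.sub_sub_self (Finset.mem_Icc.1 hi).2] at this
  · rw [Polynomial.eval_eq_sum_range, Finset.sum_range_succ, hp.coeff_natDegree, one_mul] at h1
    rw [← h1, add_comm]
    congr 1
    refine Finset.sum_nbij' (fun i => p.natDegree - i) (fun i => p.natDegree - i) ?_ ?_ ?_ ?_ ?_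
    · intro i hi; simp at hi ⊢; omega
    · intro i hi; simp at hi ⊢; omega
    · intro i hi; simp at hi ⊢; omega
    · intro i hi; simp at hi ⊢; omega
    · intro i hi; rfl

lemma aux_prod {x y : R} (hM : maximalIdeal R = Ideal.span {x, y}) (l : ℕ → R) (s : R) (n : ℕ) :
    ∃ w ∈ maximalIdeal R ^ (n - 1), ∏ j ∈ Finset.range n, (x - l j * y) =
      (∏ j ∈ Finset.range n, (s - l j)) * y ^ n + (x - s * y) * w := by
  have hx : x ∈ maximalIdeal R := by rw [hM]; exact Ideal.subset_span (by simp)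
  have hy : y ∈ maximalIdeal R := by rw [hM]; exact Ideal.subset_span (by simp)
  induction n with
  | zero => exact ⟨0, zero_mem _, by simp⟩
  | succ n ih =>
    obtain ⟨w, hw, hw'⟩ := ih
    refine ⟨∏ j ∈ Finset.range n, (x - l j * y) + (s - l n) * (y * w), ?_, ?_⟩
    · rw [Nat.add_sub_cancel]
      refine add_mem ?_ (Ideal.mul_mem_left _ _ ?_)
      · have : ∏ j ∈ Finset.range n, (x - l j * y) ∈ ∏ j ∈ Finset.range n, maximalIdeal R :=
          Ideal.prod_mem_prod fun j _ => sub_mem hx (Ideal.mul_mem_left _ _ hy)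
        simpa using this
      · have := Ideal.mul_mem_mul hy hw
        rw [← pow_succ'] at this
        exact Ideal.pow_le_pow_right (by omega) this
    · rw [Finset.prod_range_succ, Finset.prod_range_succ, pow_succ]
      linear_combination (s - l n) * y * hw'

lemma aux_contracted [Infinite (ResidueField R)] (hdim : ringKrullDim R = 2) {x y : R}
    (hM : maximalIdeal R = Ideal.span {x, y}) (I : Ideal R) (hI : I.IsComplete)
    (l : ℕ → R) (hl : Function.Injective fun i => residue R (l i)) :
    ∃ n, ∀ z, (x - l n * y) * z ∈ maximalIdeal R * I → z ∈ I := by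
  have := aux_domain hdim hM
  have hx : x ∈ maximalIdeal R := by rw [hM]; exact Ideal.subset_span (by simp)
  have hy : y ∈ maximalIdeal R := by rw [hM]; exact Ideal.subset_span (by simp)
  have hxl : ∀ j, x - l j * y ∈ maximalIdeal R := fun j =>
    sub_mem hx (Ideal.mul_mem_left _ _ hy)
  let J : ℕ → Ideal R := fun n =>
    Submodule.comap (LinearMap.mulLeft R (x - l n * y)) (maximalIdeal R * I)
  have hJ : ∀ n z, z ∈ J n ↔ (x - l n * y) * z ∈ maximalIdeal R * I := fun n z => Iff.rfl
  let K : ℕ →o Ideal R := ⟨fun n => I ⊔ ⨆ j ∈ Finset.range n, J j, by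
    intro a b hab
    refine sup_le_sup_left ?_ _
    exact biSup_mono fun j hj => Finset.range_mono hab hj⟩
  obtain ⟨n, hn⟩ := monotone_stabilizes_iff_noetherian.2 ‹IsNoetherianRing R› K
  refine ⟨n, fun z hz => ?_⟩
  set p : R := ∏ j ∈ Finset.range n, (x - l j * y) with hp
  have hzK : z ∈ K n := by
    rw [hn (n + 1) (by omega)]
    refine Submodule.mem_sup_right ?_
    exact (le_biSup J (i := n) (by simp)) hz
  have hKle : K n ≤ Submodule.comap (LinearMap.mulLeft R p) (maximalIdeal R ^ n * I) := by
    refine sup_le ?_ (iSup₂_le ?_)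
    · intro w hw
      refine Ideal.mul_mem_mul ?_ hw
      have : p ∈ ∏ j ∈ Finset.range n, maximalIdeal R :=
          Ideal.prod_mem_prod fun j _ => hxl j
      simpa using this
    · intro j hj w hw
      rw [Submodule.mem_comap, LinearMap.mulLeft_apply]
      rw [hp, ← Finset.prod_erase_mul _ _ hj, mul_assoc]
      have h1 : ∏ j ∈ (Finset.range n).erase j, (x - l j * y) ∈
          ∏ j ∈ (Finset.range n).erase j, maximalIdeal R :=
          Ideal.prod_mem_prod fun j _ => hxl j
      have h2 := Ideal.mul_mem_mul h1 ((hJ j w).1 hw)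
      rw [← mul_assoc, Finset.prod_const, ← pow_succ, Finset.card_erase_of_mem hj,
        Finset.card_range, Nat.sub_add_cancel (by simp at hj; omega)] at h2
      exact h2
  have hpz : p * z ∈ maximalIdeal R ^ n * I := hKle hzK
  have hw : ∀ w ∈ maximalIdeal R ^ (n - 1),
      (x - l n * y) * w * z ∈ maximalIdeal R ^ n * I := by
    intro w hw
    have h1 := Ideal.mul_mem_mul hw hz
    rw [← mul_assoc, ← pow_succ] at h1
    have h2 := Ideal.mul_mono_left (I := maximalIdeal R ^ (n - 1 + 1))
      (Ideal.pow_le_pow_right (by omega : n ≤ n - 1 + 1)) h1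
    convert h2 using 1
    ring
  obtain ⟨w, hw1, hw2⟩ := aux_prod hM l (l n) n
  have hu : IsUnit (∏ j ∈ Finset.range n, (l n - l j)) := by
    by_contra hcon
    have h1 := (residue_eq_zero_iff _).2 ((mem_maximalIdeal (R := R) _).2 hcon)
    rw [map_prod, Finset.prod_eq_zero_iff] at h1
    obtain ⟨j, hj, h1⟩ := h1
    rw [map_sub, sub_eq_zero] at h1
    have := hl h1
    simp at hj
    omega
  have hyz : y ^ n * z ∈ maximalIdeal R ^ n * I := by
    rw [← Ideal.unit_mul_mem_iff_mem _ hu]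
    convert sub_mem hpz (hw w hw1) using 1
    rw [hp, hw2]; ring
  apply hI
  refine aux_det I (maximalIdeal R ^ n) ?_ z ?_
  · intro h0
    apply aux_notMem hdim hM n
    have : y ^ n ∈ maximalIdeal R ^ n := Ideal.pow_mem_pow hy n
    rw [h0, Ideal.mem_bot] at this
    rw [this]; exact zero_mem _
  · intro v hv
    obtain ⟨a, ha, b, hb, rfl⟩ := Submodule.mem_sup.1 (aux_pow_le (aux_coord hM (l n)) n hv)
    obtain ⟨c, rfl⟩ := Ideal.mem_span_singleton'.1 hb
    obtain ⟨a, ha1, rfl⟩ := Ideal.mem_span_singleton_mul.1 ha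
    rw [mul_comm I]
    convert add_mem (hw a ha1) (Ideal.mul_mem_left _ c hyz) using 1
    ring

/-- length of quotients by nested ideals is additive -/
lemma aux_length_add (A B : Ideal R) (h : B ≤ A) :
    Module.length R (R ⧸ B) = Module.length R (idealQuot A B) + Module.length R (R ⧸ A) := by
  refine Module.length_eq_add_of_exact
    (Submodule.mapQ (Submodule.comap A.subtype B) B A.subtype le_rfl)
    (Submodule.factor h) ?_ (Submodule.factor_surjective h) ?_
  · rw [← LinearMap.ker_eq_bot, Submodule.ker_mapQ]
    simp
  · rw [LinearMap.exact_iff]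
    rw [Submodule.factor, Submodule.ker_mapQ, Submodule.range_mapQ]
    simp

lemma aux_length_mul (x : R) (B I : Ideal R) (h : ∀ z, x * z ∈ B ↔ z ∈ I) :
    Module.length R (R ⧸ B) =
      Module.length R (R ⧸ I) + Module.length R (R ⧸ (B ⊔ Ideal.span {x})) := by
  have hle : I ≤ Submodule.comap (LinearMap.mulLeft R x) B := fun z hz => (h z).2 hz
  have hge : Submodule.comap (LinearMap.mulLeft R x) B = I :=
    le_antisymm (fun z hz => (h z).1 hz) hle
  refine Module.length_eq_add_of_exact
    (Submodule.mapQ I B (LinearMap.mulLeft R x) hle)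
    (Submodule.factor (le_sup_left : B ≤ B ⊔ Ideal.span {x})) ?_
    (Submodule.factor_surjective _) ?_
  · rw [← LinearMap.ker_eq_bot, Submodule.ker_mapQ, hge]
    simp
  · rw [LinearMap.exact_iff]
    rw [Submodule.factor, Submodule.ker_mapQ, Submodule.range_mapQ]
    have hr : LinearMap.range (LinearMap.mulLeft R x) = Ideal.span {x} := by
      ext z
      simp [Ideal.mem_span_singleton, dvd_def, eq_comm]
    rw [hr, Submodule.comap_id, Submodule.map_sup]
    simp

lemma aux_length_x (hdim : ringKrullDim R = 2) {x y : R}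
    (hM : maximalIdeal R = Ideal.span {x, y}) (n : ℕ) :
    Module.length R (R ⧸ (maximalIdeal R ^ n ⊔ Ideal.span {x})) = n := by
  have hy : y ∈ maximalIdeal R := by rw [hM]; exact Ideal.subset_span (by simp)
  induction n with
  | zero =>
    rw [pow_zero, Ideal.one_eq_top, top_sup_eq]
    simp only [Nat.cast_zero]
    rw [Module.length_eq_zero_iff]
    exact Submodule.Quotient.subsingleton_iff.2 rfl
  | succ n ih =>
    rw [aux_length_mul (y ^ n) _ (maximalIdeal R)]
    · have h1 : maximalIdeal R ^ (n + 1) ⊔ Ideal.span {x} ⊔ Ideal.span {y ^ n} =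
          maximalIdeal R ^ n ⊔ Ideal.span {x} := by
        apply le_antisymm
        · refine sup_le (sup_le_sup_right (Ideal.pow_le_pow_right (by omega)) _) ?_
          refine le_sup_of_le_left ?_
          rw [Ideal.span_singleton_le_iff_mem]
          exact Ideal.pow_mem_pow hy n
        · refine sup_le ?_ (le_sup_of_le_left le_sup_right)
          refine (aux_pow_le hM n).trans (sup_le_sup_right ?_ _)
          exact le_sup_of_le_right Ideal.mul_le_left
      rw [h1, ih]
      have h2 : IsSimpleModule R (R ⧸ maximalIdeal R) := by
        rw [isSimpleModule_iff_isCoatom]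
        exact Ideal.isMaximal_def.1 (maximalIdeal.isMaximal R)
      rw [Module.length_eq_one_iff.2 h2]
      push_cast
      rw [add_comm]
    · intro z
      constructor
      · intro h
        by_contra hz
        have hu : IsUnit z := by
          by_contra hn
          exact hz ((mem_maximalIdeal (R := R) _).2 hn)
        rw [mul_comm, Ideal.unit_mul_mem_iff_mem _ hu, sup_comm] at h
        exact aux_notMem hdim hM n h
      · intro hz
        refine Submodule.mem_sup_left ?_
        rw [pow_succ]
        exact Ideal.mul_mem_mul (Ideal.pow_mem_pow hy n) hz

lemma aux_length_step (hdim : ringKrullDim R = 2) {x y : R}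
    (hM : maximalIdeal R = Ideal.span {x, y}) (I : Ideal R) (r : ℕ)
    (hI : I ⊔ Ideal.span {x} = maximalIdeal R ^ r ⊔ Ideal.span {x})
    (hx : ∀ z, x * z ∈ maximalIdeal R * I → z ∈ I) :
    Module.length R (R ⧸ (maximalIdeal R * I)) = Module.length R (R ⧸ I) + (r + 1 : ℕ) := by
  have hxM : x ∈ maximalIdeal R := by rw [hM]; exact Ideal.subset_span (by simp)
  rw [aux_length_mul x _ I (fun z => ⟨hx z, fun hz => Ideal.mul_mem_mul hxM hz⟩)]
  have key : ∀ A : Ideal R, maximalIdeal R * A ⊔ Ideal.span {x} =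
      maximalIdeal R * (A ⊔ Ideal.span {x}) ⊔ Ideal.span {x} := by
    intro A
    rw [Ideal.mul_sup, sup_assoc, sup_eq_right.2 (Ideal.mul_le_right : maximalIdeal R *
      Ideal.span {x} ≤ _)]
  rw [key I, hI, ← key, ← pow_succ', aux_length_x hdim hM]

lemma aux_length_pow [Infinite (ResidueField R)] (hdim : ringKrullDim R = 2) {x y : R}
    (hM : maximalIdeal R = Ideal.span {x, y}) (r : ℕ) :
    Module.length R (R ⧸ (maximalIdeal R ^ (r + 1))) =
      Module.length R (R ⧸ (maximalIdeal R ^ r)) + (r + 1 : ℕ) := by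
  rw [pow_succ']
  refine aux_length_step hdim hM _ r rfl fun z hz => ?_
  rw [← pow_succ'] at hz
  exact aux_colon_pow hdim hM r z hz

lemma aux_length_pow_ne_top [Infinite (ResidueField R)] (hdim : ringKrullDim R = 2) {x y : R}
    (hM : maximalIdeal R = Ideal.span {x, y}) (r : ℕ) :
    Module.length R (R ⧸ (maximalIdeal R ^ r)) ≠ ⊤ := by
  induction r with
  | zero =>
    rw [pow_zero, Ideal.one_eq_top]
    rw [Module.length_eq_zero_iff.2 (Submodule.Quotient.subsingleton_iff.2 rfl)]
    simp
  | succ n ih =>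
    rw [aux_length_pow hdim hM]
    exact WithTop.add_ne_top.2 ⟨ih, ENat.natCast_ne_top _⟩

lemma aux_length_quot [Infinite (ResidueField R)] (hdim : ringKrullDim R = 2) {x y : R}
    (hM : maximalIdeal R = Ideal.span {x, y}) (A B : Ideal R) (h : B ≤ A) (n : ℕ)
    (hA : maximalIdeal R ^ n ≤ A) (r : ℕ)
    (hl : Module.length R (R ⧸ B) = Module.length R (R ⧸ A) + (r + 1 : ℕ)) :
    Module.length R (idealQuot A B) = (r + 1 : ℕ) := by
  have hfin : Module.length R (R ⧸ A) ≠ ⊤ := by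
    refine ne_top_of_le_ne_top (aux_length_pow_ne_top hdim hM n) ?_
    exact Module.length_le_of_surjective (Submodule.factor hA) (Submodule.factor_surjective hA)
  rw [aux_length_add A B h, add_comm] at hl
  exact WithTop.add_left_cancel hfin hl

lemma aux_moduleLength (M : Type*) [AddCommGroup M] [Module R M] :
    moduleLength R M = Module.length R M := by
  apply WithBot.coe_injective
  rw [Module.coe_length, Order.krullDim_eq_iSup_length]
  congr 1
  unfold moduleLength
  apply le_antisymm
  · refine iSup₂_le fun n ⟨c, hc⟩ => ?_
    exact le_iSup (fun p : LTSeries (Submodule R M) => (p.length : ℕ∞)) (LTSeries.mk n c hc)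
  · refine iSup_le fun p => ?_
    exact le_iSup₂_of_le p.length ⟨p.toFun, p.strictMono⟩ le_rfl

lemma aux_mu (I : Ideal R) : mu I = Submodule.spanFinrank I := by
  unfold mu
  apply le_antisymm
  · apply Nat.sInf_le
    exact (IsNoetherian.noetherian I).exists_span_finset_card_eq_spanFinrank
  · refine le_csInf ?_ ?_
    · exact ⟨_, (IsNoetherian.noetherian I).exists_span_finset_card_eq_spanFinrank⟩
    · rintro n ⟨s, rfl, rfl⟩
      have := Submodule.spanFinrank_span_le_ncard_of_finite (R := R) s.finite_toSet
      simpa using this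

lemma aux_mu_length (I : Ideal R) :
    (mu I : ℕ∞) = Module.length R (idealQuot I (maximalIdeal R * I)) := by
  rw [aux_mu, spanFinrank_eq_finrank_quotient I (IsNoetherian.noetherian I)]
  let : Field (R ⧸ maximalIdeal R) := Ideal.Quotient.field _
  have e : (I ⧸ (maximalIdeal R) • (⊤ : Submodule R I)) ≃ₗ[R]
      idealQuot I (maximalIdeal R * I) := by
    refine Submodule.quotEquivOfEq _ _ ?_
    ext z
    rw [Submodule.mem_smul_top_iff]
    rfl
  have : Module.Finite (R ⧸ maximalIdeal R) (I ⧸ (maximalIdeal R) • (⊤ : Submodule R I)) :=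
    Module.Finite.of_restrictScalars_finite R _ _
  rw [← e.length_eq, Module.length_eq_of_surjective (S := R) (R := R ⧸ maximalIdeal R)
    Ideal.Quotient.mk_surjective, Module.length_eq_finrank]

end Helpers

/-- Let `(R, M)` be a two-dimensional regular local ring with algebraically closed residue
field `k`.  Then every complete `M`-primary ideal `I` of `R` is minimally generated, i.e. the
minimal number of generators satisfies `μ(I) = ord_R(I) + 1 = dim_k (M ^ r / M ^ (r + 1))`,
where `r = ord_R(I)` (here the `k`-dimension of `M ^ r / M ^ (r + 1)` is expressed as its
length as an `R`-module). -/
theorem complete_mPrimary_minimally_generated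
    (R : Type*) [CommRing R] [IsLocalRing R] [IsNoetherianRing R]
    (hdim : ringKrullDim R = 2)
    (hreg : ∃ x y : R, maximalIdeal R = Ideal.span {x, y})
    [IsAlgClosed (ResidueField R)]
    (I : Ideal R) (hIc : I.IsComplete) (hIp : I.IsMPrimary)
    (r : ℕ) (hr : I ≤ maximalIdeal R ^ r) (hr' : ¬ I ≤ maximalIdeal R ^ (r + 1)) :
    mu I = r + 1 ∧
      moduleLength R (idealQuot (maximalIdeal R ^ r) (maximalIdeal R ^ (r + 1))) =
        (r : ℕ∞) + 1 := by
  classical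
  obtain ⟨x, y, hM⟩ := hreg
  have hinf : Infinite (ResidueField R) := IsAlgClosed.instInfinite
  obtain ⟨f, hfI, hf⟩ := Set.not_subset.1 hr'
  obtain ⟨F, hF0, hF⟩ := aux_spec hM r (hr hfI) hf
  have hS : {t : ResidueField R | F.eval t ≠ 0}.Infinite := by
    have h1 : {t : ResidueField R | F.eval t = 0}.Finite := by
      refine F.roots.toFinset.finite_toSet.subset ?_
      intro t ht
      simpa [hF0] using ht
    exact h1.infinite_compl
  let φ := hS.natEmbedding
  choose l hl using fun i : ℕ => residue_surjective (R := R) (φ i : ResidueField R)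
  obtain ⟨n, hn⟩ := aux_contracted hdim hM I hIc l (by
    intro i j hij
    simp only [hl] at hij
    exact φ.injective (Subtype.ext hij))
  obtain ⟨c, hc, hc'⟩ := hF (l n) (by rw [hl]; exact (φ n).2)
  have hM' := aux_coord hM (l n)
  have hsup : I ⊔ Ideal.span {x - l n * y} = maximalIdeal R ^ r ⊔ Ideal.span {x - l n * y} := by
    apply le_antisymm (sup_le_sup_right hr _)
    refine sup_le ((aux_pow_le hM' r).trans ?_) le_sup_right
    refine sup_le (le_sup_of_le_right Ideal.mul_le_left) ?_
    rw [Ideal.span_singleton_le_iff_mem, ← Ideal.unit_mul_mem_iff_mem _ hc]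
    have := sub_mem (Submodule.mem_sup_left hfI) (Submodule.mem_sup_right hc')
    simpa using this
  obtain ⟨m, hm⟩ : ∃ m, maximalIdeal R ^ m ≤ I := by
    have h1 : I.radical = maximalIdeal R := hIp
    rw [← h1]
    exact I.exists_radical_pow_le_of_fg (IsNoetherian.noetherian _)
  constructor
  · have h1 := aux_length_quot hdim hM I (maximalIdeal R * I) Ideal.mul_le_right m hm r
      (aux_length_step hdim hM' I r hsup hn)
    rw [← aux_mu_length] at h1
    exact_mod_cast h1
  · rw [aux_moduleLength, aux_length_quot hdim hM _ _ (Ideal.pow_le_pow_right (by omega)) r le_rfl r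
      (aux_length_pow hdim hM r)]
    push_cast
    rfl
end
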